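/- arXiv:math/0204222 — 6 statements merged into one kernel-verified Lean document; each statement's English description precedes it below -/
import Mathlib

section
/- Let k ≥ 2 be a natural number and let G be a bipartite graph of finite girth g whose average degree is at least 4k. Then G contains cycles of (g/2 − 1)·k consecutive even lengths; that is, there is an even integer t such that for every i with 0 ≤ i < (g/2 − 1)·k, G contains a cycle of length t + 2i. Moreover, the shortest of these cycles has length at most twice the radius of G. -/
namespace SimpleGraph

variable {V : Type*} {G : SimpleGraph V}

lemma exists_walk_support_eq_map_range (c : ℕ → V) (m : ℕ)
    (h : ∀ t < m, G.Adj (c t) (c (t + 1))) :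
    ∃ w : G.Walk (c 0) (c m), w.support = (List.range (m + 1)).map c := by
  induction m with
  | zero => exact ⟨.nil, by simp⟩
  | succ m ih =>
    obtain ⟨w, hw⟩ := ih fun t ht ↦ h t (by omega)
    refine ⟨w.concat (h m (by omega)), ?_⟩
    rw [Walk.support_concat, hw, List.range_succ (n := m + 1)]
    simp

lemma exists_isCycle_of_injOn (c : ℕ → V) (n : ℕ) (hn : 3 ≤ n)
    (h : ∀ t, t + 1 < n → G.Adj (c t) (c (t + 1))) (h0 : G.Adj (c (n - 1)) (c 0))
    (hinj : ∀ s < n, ∀ t < n, c s = c t → s = t) :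
    ∃ (v : V) (w : G.Walk v v), w.IsCycle ∧ w.length = n := by
  obtain ⟨w, hw⟩ := exists_walk_support_eq_map_range (G := G) c (n - 1) fun t ht ↦ h t (by omega)
  have hl : w.length + 1 = n := by
    rw [← Walk.length_support, hw]; simp; omega
  refine ⟨_, .cons h0 w, ?_, by simpa using hl⟩
  rw [Walk.isCycle_iff_isPath_tail_and_le_length]
  refine ⟨?_, by simp; omega⟩
  rw [Walk.isPath_def, Walk.support_tail_of_not_nil _ (by simp), Walk.support_cons,
    List.tail_cons, hw]
  refine List.Nodup.map_on ?_ List.nodup_range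
  intro s hs t ht
  simp only [List.mem_range] at hs ht
  exact hinj s (by omega) t (by omega)

end SimpleGraph

lemma periodic_add_mul {f : ℤ → Prop} {P : ℤ} (h : ∀ j, f (j + P) ↔ f j) (q j : ℤ) :
    f (j + P * q) ↔ f j := by
  induction q using Int.induction_on with
  | zero => simp
  | succ i ih => rw [← ih, ← h (j + P * i)]; ring_nf
  | pred i ih => rw [← ih, ← h (j + P * (-i - 1))]; ring_nf

lemma iff_of_iff_on_interval {f g : ℤ → Prop} {P : ℤ} (hP : 0 < P) (hf : ∀ j, f (j + P) ↔ f j)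
    (hg : ∀ j, g (j + P) ↔ g j) (l : ℤ) (h : ∀ a, l ≤ a → a < l + P → (f a ↔ g a)) (j : ℤ) :
    f j ↔ g j := by
  have hj : j = l + (j - l) % P + P * ((j - l) / P) := by
    have := Int.emod_add_mul_ediv (j - l) P
    linarith
  have h0 := Int.emod_nonneg (j - l) hP.ne'
  have h1 := Int.emod_lt_of_pos (j - l) hP
  rw [hj, periodic_add_mul hf, periodic_add_mul hg]
  exact h _ (by linarith) (by linarith)

lemma periodic_two_of_reflections {f : ℤ → Prop} {n m r : ℤ} (hr : 2 ≤ r) (hrn : 2 * r ≤ n)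
    (hm0 : 0 < m) (hmn : m < n)
    (hn : ∀ j, f (j + n) ↔ f j) (hm : ∀ j, f (j + m) ↔ f j)
    (h₁ : ∀ a, 0 ≤ a → a < m → a < n - r → m - 1 - a < r → (f (-a) ↔ f (r - (m - 1 - a))))
    (h₂ : ∀ a, 0 ≤ a → a < m → a < r → m - 1 - a < n - r → (f a ↔ f (r + (m - 1 - a))))
    (h₃ : ∀ a, 0 ≤ a → a < m → m - 1 < n - r → (f (-a) ↔ f (r + (m - 1 - a)))) (j : ℤ) :
    f (j + 2) ↔ f j := by
  have h₁' : ∀ a, 0 ≤ a → a < m → a < n - r → m - 1 - a < r → (f (-a) ↔ f (r + 1 + a)) := by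
    intro a ha hb hc hd
    rw [h₁ a ha hb hc hd, ← hm]; ring_nf
  have h₂' : ∀ a, 0 ≤ a → a < m → a < r → m - 1 - a < n - r → (f a ↔ f (r - 1 - a)) := by
    intro a ha hb hc hd
    rw [h₂ a ha hb hc hd, ← hm (r - 1 - a)]; ring_nf
  have key : ∃ P, 0 < P ∧ (∀ j, f (j + P) ↔ f j) ∧
      (∃ l, ∀ a, l ≤ a → a < l + P → (f (-a) ↔ f (r + 1 + a))) ∧
      (∃ l, ∀ a, l ≤ a → a < l + P → (f a ↔ f (r - 1 - a))) := by
    rcases lt_or_ge m r with h | h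
    · exact ⟨m, hm0, hm,
        ⟨0, fun a _ _ ↦ h₁' a (by omega) (by omega) (by omega) (by omega)⟩,
        ⟨0, fun a _ _ ↦ h₂' a (by omega) (by omega) (by omega) (by omega)⟩⟩
    rcases le_or_gt m (n - r) with h' | h'
    · have hp : ∀ j, f (-j) ↔ f (r - 1 - j) := by
        refine iff_of_iff_on_interval (f := fun j ↦ f (-j)) (g := fun j ↦ f (r - 1 - j)) hm0
          (fun j ↦ ?_) (fun j ↦ ?_) 0 fun a ha hb ↦ ?_
        · rw [← hm]; ring_nf
        · rw [← hm]; ring_nf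
        · rw [h₃ a ha (by omega) (by omega), ← hm (r - 1 - a)]; ring_nf
      refine ⟨r - 1, by omega, fun j ↦ ?_,
        ⟨m - r, fun a _ _ ↦ h₁' a (by omega) (by omega) (by omega) (by omega)⟩,
        ⟨0, fun a _ _ ↦ h₂' a (by omega) (by omega) (by omega) (by omega)⟩⟩
      have := hp (-j)
      rw [neg_neg] at this
      rw [this]; ring_nf
    · refine ⟨n - m, by omega, fun j ↦ ?_,
        ⟨m - r, fun a _ _ ↦ h₁' a (by omega) (by omega) (by omega) (by omega)⟩,
        ⟨m - (n - r), fun a _ _ ↦ h₂' a (by omega) (by omega) (by omega) (by omega)⟩⟩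
      rw [← hn j, ← hm (j + (n - m))]; ring_nf
  obtain ⟨P, hP, hf, ⟨l₁, k₁⟩, l₂, k₂⟩ := key
  have e₁ : ∀ j, f (-j) ↔ f (r + 1 + j) := by
    refine iff_of_iff_on_interval (f := fun j ↦ f (-j)) (g := fun j ↦ f (r + 1 + j)) hP
      (fun j ↦ ?_) (fun j ↦ ?_) l₁ k₁
    · rw [← hf]; ring_nf
    · rw [← hf (r + 1 + j)]; ring_nf
  have e₂ : ∀ j, f j ↔ f (r - 1 - j) := by
    refine iff_of_iff_on_interval (f := f) (g := fun j ↦ f (r - 1 - j)) hP hf (fun j ↦ ?_) l₂ k₂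
    rw [← hf]; ring_nf
  rw [e₂ j, ← neg_neg (r - 1 - j), e₁ (-(r - 1 - j))]
  ring_nf

namespace SimpleGraph

variable {V : Type*} {G : SimpleGraph V}

/-- The values `p 0, …, p m` are the successive vertices of a path of length `m` of `G` inside
`S`. -/
structure IsPathFun (G : SimpleGraph V) (S : Set V) (m : ℕ) (p : ℕ → V) : Prop where
  mem : ∀ t ≤ m, p t ∈ S
  adj : ∀ t < m, G.Adj (p t) (p (t + 1))
  inj : ∀ s ≤ m, ∀ t ≤ m, p s = p t → s = t

lemma isPathFun_through_chord {x : ℤ → V} {n r : ℤ} (hinj : ∀ i j, x i = x j → n ∣ i - j)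
    (hadj : ∀ j, G.Adj (x j) (x (j + 1))) (hchord : G.Adj (x 0) (x r)) {m a : ℕ} (ham : a < m)
    (hmn : (m : ℤ) < n) {ε δ : ℤ} (hε : ε = 1 ∨ ε = -1) (hδ : δ = 1 ∨ δ = -1)
    (hdisj : ∀ s t : ℤ, 0 ≤ s → s ≤ a → 0 ≤ t → t ≤ m - 1 - a → ¬ n ∣ ε * s - (r + δ * t)) :
    IsPathFun G (Set.range x) m
      (fun t ↦ if t ≤ a then x (ε * (a - t)) else x (r + δ * (t - a - 1))) := by
  have hsmall : ∀ z : ℤ, n ∣ z → -n < z → z < n → z = 0 := fun z hz h1 h2 ↦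
    Int.eq_zero_of_abs_lt_dvd hz (abs_lt.2 ⟨h1, h2⟩)
  have hadj' : ∀ i j, (j = i + 1 ∨ i = j + 1) → G.Adj (x i) (x j) := by
    rintro i j (rfl | rfl)
    · exact hadj i
    · exact (hadj j).symm
  refine ⟨fun t _ ↦ ?_, fun t ht ↦ ?_, fun s hs t ht h ↦ ?_⟩
  · split_ifs <;> exact ⟨_, rfl⟩
  · rcases lt_trichotomy t a with h | rfl | h
    · rw [if_pos h.le, if_pos (by omega)]
      apply hadj'
      rcases hε with rfl | rfl <;> push_cast <;> omega
    · rw [if_pos le_rfl, if_neg (by omega)]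
      simpa using hchord
    · rw [if_neg (by omega), if_neg (by omega)]
      apply hadj'
      rcases hδ with rfl | rfl <;> push_cast <;> omega
  · split_ifs at h with h1 h2 h2
    · have := hsmall _ (hinj _ _ h) (by rcases hε with rfl | rfl <;> omega)
        (by rcases hε with rfl | rfl <;> omega)
      rcases hε with rfl | rfl <;> omega
    · exact absurd (hinj _ _ h) (hdisj _ _ (by omega) (by omega) (by omega) (by omega))
    · exact absurd (hinj _ _ h.symm) (hdisj _ _ (by omega) (by omega) (by omega) (by omega))
    · have := hsmall _ (hinj _ _ h) (by rcases hδ with rfl | rfl <;> omega)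
        (by rcases hδ with rfl | rfl <;> omega)
      rcases hδ with rfl | rfl <;> omega

/-- If a vertex property is preserved along every path of length `m` on a cycle with a short chord,
then it is preserved by moving two steps along the cycle. -/
lemma iff_add_two_of_forall_isPathFun {x : ℤ → V} {n r : ℤ}
    (hinj : ∀ i j, x i = x j → n ∣ i - j) (hper : ∀ j, x (j + n) = x j)
    (hadj : ∀ j, G.Adj (x j) (x (j + 1))) (hchord : G.Adj (x 0) (x r))
    (hr : 2 ≤ r) (hrn : 2 * r ≤ n) {m : ℕ} (hm : 0 < m) (hmn : (m : ℤ) < n) {χ : V → Prop}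
    (hχ : ∀ p, IsPathFun G (Set.range x) m p → (χ (p 0) ↔ χ (p m))) (j : ℤ) :
    χ (x (j + 2)) ↔ χ (x j) := by
  have hsmall : ∀ z : ℤ, -n < z → z < n → z ≠ 0 → ¬ n ∣ z := fun z h1 h2 h3 hz ↦
    h3 (Int.eq_zero_of_abs_lt_dvd hz (abs_lt.2 ⟨h1, h2⟩))
  have hthrough : ∀ a : ℕ, a < m → ∀ ε δ : ℤ, (ε = 1 ∨ ε = -1) → (δ = 1 ∨ δ = -1) →
      (∀ s t : ℤ, 0 ≤ s → s ≤ a → 0 ≤ t → t ≤ m - 1 - a → ¬ n ∣ ε * s - (r + δ * t)) →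
      (χ (x (ε * a)) ↔ χ (x (r + δ * (m - 1 - a)))) := by
    intro a ha ε δ hε hδ h
    have := hχ _ (isPathFun_through_chord hinj hadj hchord ha hmn hε hδ h)
    rw [if_pos (by omega), if_neg (by omega)] at this
    rw [show (m : ℤ) - 1 - a = m - a - 1 by ring]
    simpa using this
  refine periodic_two_of_reflections (f := fun j ↦ χ (x j)) (m := m) hr hrn (by omega) hmn
    (fun j ↦ by simp only [hper]) (fun j ↦ ?_) (fun a h0 h1 h2 h3 ↦ ?_) (fun a h0 h1 h2 h3 ↦ ?_)
    (fun a h0 h1 h2 ↦ ?_) j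
  · have := hχ (fun t ↦ x (j + t)) ⟨fun t _ ↦ ⟨_, rfl⟩, fun t _ ↦ ?_, fun s hs t ht h ↦ ?_⟩
    · simpa using this.symm
    · simpa [add_assoc] using hadj (j + t)
    · by_contra hst
      exact hsmall _ (by omega) (by omega) (by omega) (hinj _ _ h)
  all_goals lift a to ℕ using h0
  · simpa [sub_eq_add_neg] using hthrough a (by omega) (-1) (-1) (by simp) (by simp)
      fun s t _ _ _ _ ↦ hsmall _ (by omega) (by omega) (by omega)
  · simpa using hthrough a (by omega) 1 1 (by simp) (by simp)
      fun s t _ _ _ _ ↦ hsmall _ (by omega) (by omega) (by omega)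
  · simpa using hthrough a (by omega) (-1) 1 (by simp) (by simp)
      fun s t _ _ _ _ ↦ hsmall _ (by omega) (by omega) (by omega)

end SimpleGraph

namespace SimpleGraph

variable {V : Type*} {G : SimpleGraph V}

/-- The level function `d` and the parent function `par` of a spanning forest of `G` such that
adjacent vertices lie on consecutive levels and in the same tree. -/
structure IsLayering (G : SimpleGraph V) (d : V → ℕ) (par : V → V) : Prop where
  adj_par : ∀ v, d v ≠ 0 → G.Adj v (par v)
  level_par : ∀ v, d v ≠ 0 → d (par v) + 1 = d v
  level_adj : ∀ u v, G.Adj u v → d u = d v + 1 ∨ d v = d u + 1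
  root_adj : ∀ u v, G.Adj u v → par^[d u] u = par^[d v] v

namespace IsLayering

variable {d : V → ℕ} {par : V → V}

lemma level_iterate (hL : IsLayering G d par) (v : V) (s : ℕ) (hs : s ≤ d v) :
    d (par^[s] v) + s = d v := by
  induction s with
  | zero => simp
  | succ s ih =>
    have := ih (by omega)
    rw [Function.iterate_succ_apply']
    have := hL.level_par (par^[s] v) (by omega)
    omega

lemma adj_iterate (hL : IsLayering G d par) (v : V) (s : ℕ) (hs : s < d v) :
    G.Adj (par^[s] v) (par^[s + 1] v) := by
  rw [Function.iterate_succ_apply']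
  have := hL.level_iterate v s hs.le
  exact hL.adj_par _ (by omega)

/-- Close up a path between two vertices of one level through their lowest common ancestor. -/
lemma exists_isCycle (hL : IsLayering G d par) {i h m : ℕ} {p : ℕ → V}
    (hp : IsPathFun G {v | d v = i ∨ d v = i + 1} m p) (hm : 0 < m) (hi : h + 1 ≤ i)
    (h0 : d (p 0) = i) (h1 : d (p m) = i) (hne : par^[h] (p 0) ≠ par^[h] (p m))
    (heq : par^[h + 1] (p 0) = par^[h + 1] (p m)) :
    ∃ (v : V) (w : G.Walk v v), w.IsCycle ∧ w.length = m + 2 * (h + 1) := by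
  have la : ∀ s ≤ h + 1, d (par^[s] (p 0)) + s = i := fun s hs ↦ by
    rw [hL.level_iterate _ _ (by omega), h0]
  have lb : ∀ s ≤ h + 1, d (par^[s] (p m)) + s = i := fun s hs ↦ by
    rw [hL.level_iterate _ _ (by omega), h1]
  have hab : ∀ s ≤ h + 1, ∀ t ≤ h, par^[s] (p m) ≠ par^[t] (p 0) := by
    intro s hs t ht hst
    have h2 := la t (by omega)
    have h3 := lb s hs
    rw [hst] at h3
    obtain rfl : s = t := by omega
    apply hne
    obtain ⟨q, rfl⟩ := Nat.exists_eq_add_of_le' ht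
    rw [Function.iterate_add_apply, Function.iterate_add_apply, hst]
  have hlow : ∀ t ≤ m, i ≤ d (p t) := fun t ht ↦ by
    rcases hp.mem t ht with h | h <;> omega
  refine exists_isCycle_of_injOn (fun t ↦ if t ≤ m then p t else
    if t ≤ m + (h + 1) then par^[t - m] (p m) else par^[m + 2 * (h + 1) - t] (p 0)) _ (by omega)
    (fun t ht ↦ ?_) ?_ fun s hs t ht hst ↦ ?_
  · rcases lt_trichotomy t m with hlt | rfl | hlt
    · rw [if_pos hlt.le, if_pos (by omega)]
      exact hp.adj t hlt
    · rw [if_pos le_rfl, if_neg (by omega), if_pos (by omega)]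
      simpa using hL.adj_iterate (p t) 0 (by omega)
    · rw [if_neg (show ¬ t ≤ m by omega), if_neg (show ¬ t + 1 ≤ m by omega)]
      rcases lt_trichotomy t (m + (h + 1)) with hlt' | rfl | hlt'
      · rw [if_pos (show t ≤ m + (h + 1) by omega), if_pos (show t + 1 ≤ m + (h + 1) by omega),
          show t + 1 - m = t - m + 1 by omega]
        exact hL.adj_iterate _ _ (by omega)
      · rw [if_pos le_rfl, if_neg (show ¬ m + (h + 1) + 1 ≤ m + (h + 1) by omega),
          show m + (h + 1) - m = h + 1 by omega, ← heq, show m + 2 * (h + 1) - (m + (h + 1) + 1) = h by omega]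
        exact (hL.adj_iterate _ _ (by omega)).symm
      · rw [if_neg (show ¬ t ≤ m + (h + 1) by omega),
          if_neg (show ¬ t + 1 ≤ m + (h + 1) by omega), show m + 2 * (h + 1) - t =
          m + 2 * (h + 1) - (t + 1) + 1 by omega]
        exact (hL.adj_iterate _ _ (by omega)).symm
  · rw [if_neg (show ¬ m + 2 * (h + 1) - 1 ≤ m by omega), if_pos (show 0 ≤ m by omega)]
    rcases Nat.eq_zero_or_pos h with rfl | hh
    · rw [if_pos (by omega), show m + 2 * (0 + 1) - 1 - m = 0 + 1 by omega, ← heq]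
      simpa using (hL.adj_iterate (p 0) 0 (by omega)).symm
    · rw [if_neg (show ¬ m + 2 * (h + 1) - 1 ≤ m + (h + 1) by omega),
        show m + 2 * (h + 1) - (m + 2 * (h + 1) - 1) = 0 + 1 by omega]
      simpa using (hL.adj_iterate (p 0) 0 (by omega)).symm
  · have key : ∀ s t, s ≤ m → m < t → t < m + 2 * (h + 1) → p s ≠
        if t ≤ m + (h + 1) then par^[t - m] (p m) else par^[m + 2 * (h + 1) - t] (p 0) := by
      intro s t hs ht ht' hst
      have h2 := hlow s hs
      split_ifs at hst with h3
      · have := lb (t - m) (by omega)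
        rw [← hst] at this
        omega
      · have := la (m + 2 * (h + 1) - t) (by omega)
        rw [← hst] at this
        omega
    by_cases hsm : s ≤ m <;> by_cases htm : t ≤ m
    · rw [if_pos hsm, if_pos htm] at hst
      exact hp.inj s hsm t htm hst
    · rw [if_pos hsm, if_neg htm] at hst
      exact absurd hst (key s t hsm (by omega) ht)
    · rw [if_neg hsm, if_pos htm] at hst
      exact absurd hst.symm (key t s htm (by omega) hs)
    · rw [if_neg hsm, if_neg htm] at hst
      split_ifs at hst with h2 h3 h3
      · have e1 := lb (s - m) (by omega)
        have e2 := lb (t - m) (by omega)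
        rw [hst] at e1
        omega
      · exact absurd hst (hab _ (by omega) _ (by omega))
      · exact absurd hst.symm (hab _ (by omega) _ (by omega))
      · have e1 := la (m + 2 * (h + 1) - s) (by omega)
        have e2 := la (m + 2 * (h + 1) - t) (by omega)
        rw [hst] at e1
        omega

end IsLayering

lemma Colorable.dist_ne_of_adj (hG : G.Colorable 2) {r u v : V} (hu : G.Reachable r u)
    (huv : G.Adj u v) : G.dist r u ≠ G.dist r v := by
  obtain ⟨c⟩ := hG
  let c' : G.Coloring Bool := G.recolorOfEquiv finTwoEquiv c
  obtain ⟨p, hp⟩ := hu.exists_walk_length_eq_dist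
  obtain ⟨q, hq⟩ := (hu.trans huv.reachable).exists_walk_length_eq_dist
  intro h
  have h1 := c'.even_length_iff_congr p
  have h2 := c'.even_length_iff_congr q
  rw [hp, h] at h1
  rw [hq, h1] at h2
  have h3 := c'.valid huv
  revert h2 h3
  cases c' r <;> cases c' u <;> cases c' v <;> simp

lemma Colorable.isLayering_of_roots (hG : G.Colorable 2) (ρ : V → V)
    (hρ : ∀ v, G.Reachable (ρ v) v) (hρ' : ∀ u v, G.Adj u v → ρ u = ρ v) :
    ∃ par, IsLayering G (fun v ↦ G.dist (ρ v) v) par := by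
  have hpar : ∀ v, ∃ w, G.dist (ρ v) v ≠ 0 → G.Adj v w ∧ G.dist (ρ w) w + 1 = G.dist (ρ v) v := by
    intro v
    by_cases hv : G.dist (ρ v) v = 0
    · exact ⟨v, fun h ↦ absurd hv h⟩
    obtain ⟨p, hp⟩ := (hρ v).symm.exists_walk_length_eq_dist
    rw [dist_comm] at hp
    have hne : v ≠ ρ v := fun h ↦ hv ((hρ v).dist_eq_zero_iff.2 h.symm)
    obtain ⟨w, hvw, q, rfl⟩ := Walk.exists_eq_cons_of_ne hne p
    refine ⟨w, fun _ ↦ ⟨hvw, ?_⟩⟩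
    have h1 := G.dist_le q
    rw [dist_comm] at h1
    rw [← hρ' _ _ hvw]
    rw [Walk.length_cons] at hp
    have h2 : G.dist (ρ v) v ≤ G.dist (ρ v) w + G.dist w v :=
      Reachable.dist_triangle_left ((hρ v).trans hvw.reachable) v
    rw [dist_eq_one_iff_adj.2 hvw.symm] at h2
    omega
  choose par hpar using hpar
  have hroot : ∀ n v, G.dist (ρ v) v = n → par^[n] v = ρ v := by
    intro n
    induction n with
    | zero => exact fun v hv ↦ ((hρ v).dist_eq_zero_iff.1 hv).symm
    | succ n ih =>
      intro v hv
      obtain ⟨h1, h2⟩ := hpar v (by omega)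
      rw [Function.iterate_succ_apply, ih _ (by omega), hρ' _ _ h1]
  refine ⟨par, fun v hv ↦ (hpar v hv).1, fun v hv ↦ (hpar v hv).2, fun u v huv ↦ ?_,
    fun u v huv ↦ ?_⟩
  · have h1 := hG.dist_ne_of_adj (hρ u) huv
    have h2 : G.dist (ρ u) v ≤ G.dist (ρ u) u + G.dist u v :=
      Reachable.dist_triangle_left (hρ u) v
    have h3 : G.dist (ρ u) u ≤ G.dist (ρ u) v + G.dist v u :=
      Reachable.dist_triangle_left ((hρ u).trans huv.reachable) u
    rw [dist_eq_one_iff_adj.2 huv] at h2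
    rw [dist_eq_one_iff_adj.2 huv.symm] at h3
    simp only [← hρ' _ _ huv]
    omega
  · rw [hroot _ _ rfl, hroot _ _ rfl, hρ' _ _ huv]

lemma Colorable.exists_isLayering [Nonempty V] (hG : G.Colorable 2) :
    ∃ d par, IsLayering G d par ∧ ∀ v, (d v : ℕ∞) ≤ G.radius := by
  by_cases hc : G.Connected
  · obtain ⟨r, hr⟩ := G.exists_eccent_eq_radius
    obtain ⟨par, h⟩ := hG.isLayering_of_roots (fun _ ↦ r) (fun v ↦ hc r v) fun _ _ _ ↦ rfl
    refine ⟨_, par, h, fun v ↦ ?_⟩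
    rw [(hc r v).coe_dist_eq_edist, ← hr]
    exact edist_le_eccent
  · obtain ⟨par, h⟩ := hG.isLayering_of_roots (fun v ↦ (G.connectedComponentMk v).out)
      (fun v ↦ ConnectedComponent.exact (Quot.out_eq _))
      fun u v huv ↦ by rw [ConnectedComponent.sound huv.reachable]
    refine ⟨_, par, h, fun v ↦ ?_⟩
    rw [radius_eq_top_of_not_connected hc]
    exact le_top

open Finset in
/-- A set of vertices spanning many edges contains a set inducing a graph of large minimum
degree. -/
lemma exists_subset_forall_lt_card_filter_adj [DecidableEq V] [DecidableRel G.Adj] (k : ℕ)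
    (U : Finset V) (hU : 2 * k * #U < ∑ u ∈ U, #(U.filter (G.Adj u))) :
    ∃ S ⊆ U, S.Nonempty ∧ ∀ v ∈ S, k < #(S.filter (G.Adj v)) := by
  induction U using Finset.strongInduction with
  | H U ih =>
    by_cases h : ∀ v ∈ U, k < #(U.filter (G.Adj v))
    · refine ⟨U, subset_rfl, ?_, h⟩
      by_contra hne
      rw [not_nonempty_iff_eq_empty] at hne
      simp [hne] at hU
    push Not at h
    obtain ⟨v, hv, hk⟩ := h
    have hcard : #(U.erase v) + 1 = #U := card_erase_add_one hv
    have hstep : ∀ u, #(U.filter (G.Adj u)) =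
        #((U.erase v).filter (G.Adj u)) + if G.Adj u v then 1 else 0 := by
      intro u
      rw [← insert_erase hv, filter_insert, insert_erase hv]
      split_ifs <;> simp
    have hdeg : ∑ u ∈ U.erase v, (if G.Adj u v then 1 else 0) ≤ k := by
      rw [← card_filter]
      refine le_trans (card_le_card fun u hu ↦ ?_) hk
      simp only [mem_filter, mem_erase] at hu ⊢
      exact ⟨hu.1.2, hu.2.symm⟩
    have hsum : ∑ u ∈ U, #(U.filter (G.Adj u)) ≤
        ∑ u ∈ U.erase v, #((U.erase v).filter (G.Adj u)) + 2 * k := by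
      rw [← add_sum_erase _ _ hv, sum_congr rfl fun u _ ↦ hstep u, sum_add_distrib]
      omega
    have hmul : 2 * k * #U = 2 * k * #(U.erase v) + 2 * k := by rw [← hcard]; ring
    obtain ⟨S, hS, h⟩ := ih (U.erase v) (erase_ssubset hv) (by omega)
    exact ⟨S, hS.trans (erase_subset _ _), h⟩

open Finset in
/-- Some two consecutive levels span more than half of their share of the edges. -/
lemma IsLayering.exists_dense_levels [Fintype V] [DecidableEq V] [DecidableRel G.Adj] [Nonempty V]
    {d : V → ℕ} {par : V → V} (hL : IsLayering G d par) {k : ℕ} (hk : 0 < k)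
    (he : 4 * k * Fintype.card V ≤ 2 * G.edgeSet.ncard) :
    ∃ i, ∃ U : Finset V, (∀ v ∈ U, d v = i ∨ d v = i + 1) ∧
      2 * k * #U < ∑ u ∈ U, #(U.filter (G.Adj u)) := by
  let T : ℕ → Finset V := fun i ↦ univ.filter fun v ↦ d v = i ∨ d v = i + 1
  by_contra! hcon
  have hT : ∀ i, ∑ u ∈ T i, #((T i).filter (G.Adj u)) ≤ 2 * k * #(T i) := fun i ↦
    hcon i (T i) (by simp [T])
  let M := univ.sup d + 1
  have hM : ∀ v, d v < M := fun v ↦ Nat.lt_succ_of_le (le_sup (mem_univ v))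
  have hsize : ∑ i ∈ range M, #(T i) < 2 * Fintype.card V := by
    have hswap : ∑ i ∈ range M, #(T i) =
        ∑ v, #((range M).filter fun i ↦ d v = i ∨ d v = i + 1) := by
      simp only [T, card_filter]
      exact sum_comm
    have hle : ∀ v, #((range M).filter fun i ↦ d v = i ∨ d v = i + 1) ≤ 2 := fun v ↦ by
      refine (card_le_card (t := {d v, d v - 1}) fun i hi ↦ ?_).trans card_le_two
      simp only [mem_filter, mem_insert, mem_singleton] at hi ⊢
      omega
    obtain ⟨v⟩ := ‹Nonempty V›
    have hroot : d (par^[d v] v) = 0 := by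
      have := hL.level_iterate v (d v) le_rfl
      omega
    have hlt : #((range M).filter fun i ↦ d (par^[d v] v) = i ∨ d (par^[d v] v) = i + 1) < 2 := by
      refine Nat.lt_succ_of_le ((card_le_card (t := {0}) fun i hi ↦ ?_).trans (by simp))
      simp only [mem_filter, mem_singleton] at hi ⊢
      omega
    rw [hswap, mul_comm, ← card_univ, ← smul_eq_mul, ← sum_const]
    exact sum_lt_sum (fun v _ ↦ hle v) ⟨_, mem_univ _, hlt⟩
  have hedges : 2 * G.edgeSet.ncard ≤ ∑ i ∈ range M, ∑ u ∈ T i, #((T i).filter (G.Adj u)) := by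
    rw [Set.ncard_eq_toFinset_card', ← edgeFinset, ← sum_degrees_eq_twice_card_edges]
    have h1 : ∀ v, G.degree v = #(univ.filter (G.Adj v)) := fun v ↦ by
      rw [← card_neighborFinset_eq_degree, neighborFinset_eq_filter]
    have h2 : ∀ U : Finset V, ∑ u ∈ U, #(U.filter (G.Adj u)) =
        #((U ×ˢ U).filter fun q ↦ G.Adj q.1 q.2) := fun U ↦ by
      simp only [card_filter, sum_product]
    simp only [h1]
    rw [h2 univ]
    simp only [h2]
    refine le_trans (card_le_card fun q hq ↦ ?_) card_biUnion_le
    simp only [mem_filter, mem_product, mem_univ, true_and, mem_biUnion, mem_range, T] at hq ⊢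
    have h3 := hM q.1
    have h4 := hM q.2
    rcases hL.level_adj _ _ hq with h | h
    · exact ⟨d q.2, h4, ⟨by omega, by omega⟩, hq⟩
    · exact ⟨d q.1, h3, ⟨by omega, by omega⟩, hq⟩
  have h5 : ∑ i ∈ range M, ∑ u ∈ T i, #((T i).filter (G.Adj u)) ≤
      2 * k * ∑ i ∈ range M, #(T i) := by
    rw [mul_sum]
    exact sum_le_sum fun i _ ↦ hT i
  have h6 : 2 * k * ∑ i ∈ range M, #(T i) < 2 * k * (2 * Fintype.card V) :=
    Nat.mul_lt_mul_of_pos_left hsize (by omega)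
  have h7 : 2 * k * (2 * Fintype.card V) = 4 * k * Fintype.card V := by ring
  omega

open Finset in
lemma exists_mem_le_of_gaps {Q : Finset ℕ} {D k : ℕ} (hD : 0 < D) (hQ : k < #Q)
    (hpos : ∀ s ∈ Q, 1 ≤ s) (hgap : ∀ s ∈ Q, ∀ t ∈ Q, s < t → s + D ≤ t) :
    ∃ s ∈ Q, (∀ t ∈ Q, t ≤ s) ∧ k * D + 1 ≤ s := by
  have hne : Q.Nonempty := card_pos.1 (by omega)
  refine ⟨Q.max' hne, Q.max'_mem hne, fun t ht ↦ Q.le_max' t ht, ?_⟩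
  have hlt : ∀ s ∈ Q, ∀ t ∈ Q, s < t → (s - 1) / D < (t - 1) / D := by
    intro s hs t ht hst
    have h1 := hgap s hs t ht hst
    have h2 := hpos s hs
    have : (s - 1) / D + 1 ≤ (t - 1) / D := by
      rw [← Nat.add_div_right _ hD]
      exact Nat.div_le_div_right (by omega)
    omega
  have hcard : #Q ≤ #(range ((Q.max' hne - 1) / D + 1)) := by
    refine card_le_card_of_injOn (fun s ↦ (s - 1) / D) (fun s hs ↦ ?_) fun s hs t ht h ↦ ?_
    · simp only [coe_range, Set.mem_Iio]
      exact Nat.lt_succ_of_le (Nat.div_le_div_right (Nat.sub_le_sub_right (Q.le_max' s hs) 1))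
    · rcases lt_trichotomy s t with h' | h' | h'
      · exact absurd h (hlt s hs t ht h').ne
      · exact h'
      · exact absurd h (hlt t ht s hs h').ne'
  rw [card_range] at hcard
  have h1 : k ≤ (Q.max' hne - 1) / D := by omega
  have h2 := (Nat.le_div_iff_mul_le hD).1 h1
  have h3 := hpos _ (Q.max'_mem hne)
  omega

open Finset in
/-- Large minimum degree and large girth force a long cycle with a chord. -/
lemma exists_long_cycle_with_chord [DecidableEq V] [DecidableRel G.Adj] {k g : ℕ} (hk : 2 ≤ k)
    (hg : 3 ≤ g) (hgirth : ∀ (v : V) (w : G.Walk v v), w.IsCycle → g ≤ w.length) {S : Finset V}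
    (hS : S.Nonempty) (hdeg : ∀ v ∈ S, k < #(S.filter (G.Adj v))) :
    ∃ (x : ℤ → V) (n r : ℤ), (∀ j, x j ∈ S) ∧ (∀ i j, x i = x j → n ∣ i - j) ∧
      (∀ j, x (j + n) = x j) ∧ (∀ j, G.Adj (x j) (x (j + 1))) ∧ G.Adj (x 0) (x r) ∧
      2 ≤ r ∧ 2 * r ≤ n ∧ k * (g - 2) + 2 ≤ n := by
  obtain ⟨L, ⟨p, hp⟩, hL⟩ : ∃ L, (∃ p, IsPathFun G (S : Set V) L p) ∧
      ¬ ∃ p, IsPathFun G (S : Set V) (L + 1) p := by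
    by_contra! hcon
    have hall : ∀ L, ∃ p, IsPathFun G (S : Set V) L p := by
      intro L
      induction L with
      | zero =>
        obtain ⟨v, hv⟩ := hS
        exact ⟨fun _ ↦ v, fun _ _ ↦ hv, by simp, fun _ _ _ _ _ ↦ by omega⟩
      | succ L ih => exact hcon L ih
    obtain ⟨p, hp⟩ := hall #S
    have := card_le_card_of_injOn (s := range (#S + 1)) (t := S) p
      (fun t ht ↦ hp.mem t (by simpa [Nat.lt_succ_iff] using ht)) fun s hs t ht h ↦
        hp.inj s (by simpa [Nat.lt_succ_iff] using hs) t (by simpa [Nat.lt_succ_iff] using ht) h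
    rw [card_range] at this
    omega
  let Q := (Icc 1 L).filter fun t ↦ G.Adj (p 0) (p t)
  have hQmem : ∀ t ∈ Q, 1 ≤ t ∧ t ≤ L ∧ G.Adj (p 0) (p t) := by
    intro t ht
    simpa [Q, and_assoc] using ht
  have hQ : k < #Q := by
    refine (hdeg (p 0) (hp.mem 0 (by omega))).trans_le ((card_le_card fun v hv ↦ ?_).trans
      (card_image_le (f := p)))
    rw [mem_filter] at hv
    by_contra hvQ
    have hout : ∀ t ≤ L, v ≠ p t := by
      rintro t ht rfl
      apply hvQ
      refine mem_image_of_mem _ ?_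
      simp only [Q, mem_filter, mem_Icc]
      refine ⟨⟨?_, ht⟩, hv.2⟩
      rcases Nat.eq_zero_or_pos t with rfl | h
      · exact absurd hv.2 (G.loopless.irrefl _)
      · exact h
    refine hL ⟨fun t ↦ if t = 0 then v else p (t - 1), fun t ht ↦ ?_, fun t ht ↦ ?_,
      fun s hs t ht h ↦ ?_⟩
    · split_ifs
      · exact hv.1
      · exact hp.mem _ (by omega)
    · rcases Nat.eq_zero_or_pos t with rfl | h
      · simpa using hv.2.symm
      · rw [if_neg (by omega), if_neg (by omega)]
        have := hp.adj (t - 1) (by omega)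
        rwa [show t - 1 + 1 = t + 1 - 1 by omega] at this
    · split_ifs at h with h1 h2 h2
      · omega
      · exact absurd h (hout _ (by omega))
      · exact absurd h.symm (hout _ (by omega))
      · have := hp.inj _ (by omega) _ (by omega) h
        omega
  have hgap : ∀ s ∈ Q, ∀ t ∈ Q, s < t → s + (g - 2) ≤ t := by
    intro s hs t ht hst
    obtain ⟨s1, s2, s3⟩ := hQmem s hs
    obtain ⟨t1, t2, t3⟩ := hQmem t ht
    suffices h : ∃ (v : V) (w : G.Walk v v), w.IsCycle ∧ w.length = t - s + 2 by
      obtain ⟨v, w, hw, hl⟩ := h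
      have := hgirth v w hw
      omega
    refine exists_isCycle_of_injOn (fun j ↦ if j = 0 then p 0 else p (s + j - 1)) (t - s + 2)
      (by omega) (fun j hj ↦ ?_) ?_ fun i hi j hj h ↦ ?_
    · rcases Nat.eq_zero_or_pos j with rfl | h
      · simpa using s3
      · rw [if_neg (by omega), if_neg (by omega)]
        have := hp.adj (s + j - 1) (by omega)
        rwa [show s + j - 1 + 1 = s + (j + 1) - 1 by omega] at this
    · rw [if_neg (by omega), if_pos rfl, show s + (t - s + 2 - 1) - 1 = t by omega]
      exact t3.symm
    · split_ifs at h with h1 h2 h2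
      · omega
      all_goals
        have := hp.inj _ (by omega) _ (by omega) h
        omega
  obtain ⟨M, hM, hmax, hMlong⟩ := exists_mem_le_of_gaps (D := g - 2) (by omega) hQ
    (fun s hs ↦ (hQmem s hs).1) hgap
  obtain ⟨r, hr⟩ : ((Q.erase 1).erase M).Nonempty := by
    apply card_pos.1
    have h1 := pred_card_le_card_erase (s := Q) (a := 1)
    have h2 := pred_card_le_card_erase (s := Q.erase 1) (a := M)
    omega
  simp only [mem_erase] at hr
  obtain ⟨hrM, hr1, hrQ⟩ := hr
  obtain ⟨r1, r2, r3⟩ := hQmem r hrQ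
  obtain ⟨M1, M2, M3⟩ := hQmem M hM
  have hrM' := hmax r hrQ
  let n : ℤ := M + 1
  let x : ℤ → V := fun j ↦ p (j % n).toNat
  have hmod : ∀ j : ℤ, 0 ≤ j % n ∧ j % n < n := fun j ↦
    ⟨Int.emod_nonneg _ (by omega), Int.emod_lt_of_pos _ (by omega)⟩
  have hxS : ∀ j, x j ∈ S := fun j ↦ hp.mem _ (by have := hmod j; omega)
  have hxinj : ∀ i j, x i = x j → n ∣ i - j := by
    intro i j h
    have hi := hmod i
    have hj := hmod j
    have := hp.inj _ (by omega) _ (by omega) h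
    exact Int.ModEq.dvd (show j % n = i % n by omega)
  have hxper : ∀ j, x (j + n) = x j := fun j ↦ by simp [x]
  have hxadj : ∀ j, G.Adj (x j) (x (j + 1)) := by
    intro j
    have hj := hmod j
    have hj' : (j + 1) % n = (j % n + 1) % n := by simp
    simp only [x]
    rcases eq_or_ne (j % n) M with h | h
    · rw [hj', h, Int.emod_self]
      simpa using M3.symm
    · rw [hj', Int.emod_eq_of_lt (a := j % n + 1) (by omega) (by omega),
        show (j % n + 1).toNat = (j % n).toNat + 1 by omega]
      exact hp.adj _ (by omega)
  have hx0 : x 0 = p 0 := by simp [x]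
  have hxr : x r = p r := by
    simp only [x]
    rw [Int.emod_eq_of_lt (by omega) (by omega)]
    simp
  have hlen : (k : ℤ) * (g - 2) + 2 ≤ n := by
    have : ((k * (g - 2) + 1 : ℕ) : ℤ) ≤ M := by exact_mod_cast hMlong
    push_cast [Nat.cast_sub (show 2 ≤ g by omega)] at this
    omega
  rcases le_or_gt (2 * (r : ℤ)) n with h | h
  · exact ⟨x, n, r, hxS, hxinj, hxper, hxadj, by rwa [hx0, hxr], by omega, h, hlen⟩
  · refine ⟨fun j ↦ x (-j), n, n - r, fun j ↦ hxS _, fun i j hij ↦ ?_, fun j ↦ ?_, fun j ↦ ?_, ?_,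
      by omega, by omega, hlen⟩
    · have := hxinj _ _ hij
      rwa [← dvd_neg, show -(i - j) = -i - -j by ring]
    · change x (-(j + n)) = x (-j)
      rw [← hxper]
      congr 1
      ring
    · have := (hxadj (-(j + 1))).symm
      rwa [show -(j + 1) + 1 = -j by ring] at this
    · change G.Adj (x (-0)) (x (-(n - r)))
      rw [← hxper (-(n - r)), neg_zero, show -(n - r) + n = (r : ℤ) by ring, hx0, hxr]
      exact r3

end SimpleGraph

open SimpleGraph in
/-- Let `k ≥ 2` and let `G` be a bipartite graph of finite girth `g`
whose average degree is at least `4k`. Then `G` contains cycles of `(g/2 − 1)·k`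
consecutive even lengths, the shortest of which has length at most twice the radius
of `G` (radius taken as `⨅ v, ⨆ u, edist v u`). -/
theorem arithmetic_progressions_of_even_cycle_lengths
    {V : Type*} [Fintype V] [Nonempty V] (G : SimpleGraph V) (k g : ℕ)
    (hk : 2 ≤ k)
    (hbip : G.Colorable 2)
    (hgirth : G.girth = (g : ℕ∞))
    (havg : 4 * k * Fintype.card V ≤ 2 * G.edgeSet.ncard) :
    ∃ t : ℕ, Even t ∧
      (∀ i : ℕ, i < (g / 2 - 1) * k →
        ∃ (v : V) (c : G.Walk v v), c.IsCycle ∧ c.length = t + 2 * i) ∧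
      (t : ℕ∞) ≤ 2 * ⨅ v : V, ⨆ u : V, G.edist v u := by
  classical
  rw [← radius_eq_iInf_iSup_edist]
  rcases lt_or_ge g 4 with hg | hg
  · refine ⟨0, by simp, fun i hi ↦ ?_, by simp⟩
    rw [show g / 2 - 1 = 0 by omega] at hi
    omega
  have hcycle : ∀ (v : V) (w : G.Walk v v), w.IsCycle → g ≤ w.length := fun v w hw ↦ by
    rw [← Nat.cast_inj.1 hgirth]
    exact girth_le_length hw
  obtain ⟨d, par, hL, hrad⟩ := hbip.exists_isLayering
  obtain ⟨i, U, hU, hdense⟩ := hL.exists_dense_levels (by omega) havg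
  obtain ⟨S, hSU, hS, hdeg⟩ := exists_subset_forall_lt_card_filter_adj k U hdense
  obtain ⟨x, n, r, hxS, hinj, hper, hadj, hchord, hr, hrn, hlen⟩ :=
    exists_long_cycle_with_chord hk (by omega) hcycle hS hdeg
  have hxd : ∀ j, d (x j) = i ∨ d (x j) = i + 1 := fun j ↦ hU _ (hSU (hxS j))
  have hstep : ∀ j, d (x (j + 2)) = d (x j) := by
    intro j
    have h1 := hL.level_adj _ _ (hadj j)
    have h2 := hL.level_adj _ _ (hadj (j + 1))
    rw [show j + 1 + 1 = j + 2 by ring] at h2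
    have := hxd j
    have := hxd (j + 1)
    have := hxd (j + 2)
    omega
  have hroot : ∀ j, par^[d (x j)] (x j) = par^[d (x 0)] (x 0) := by
    intro j
    induction j using Int.induction_on with
    | zero => rfl
    | succ j ih => rw [← ih, hL.root_adj _ _ (hadj j)]
    | pred j ih =>
      rw [← ih, hL.root_adj _ _ (hadj (-j - 1)), sub_add_cancel]
  obtain ⟨j₀, hj₀, hj₀'⟩ : ∃ j, d (x j) = i ∧ d (x (j + 1)) = i + 1 := by
    have h1 := hL.level_adj _ _ (hadj 0)
    have h2 := hL.level_adj _ _ (hadj (0 + 1))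
    have h3 := hxd 0
    have h4 := hxd (0 + 1)
    have h5 := hxd (0 + 1 + 1)
    rcases h3 with h3 | h3
    · exact ⟨0, h3, by omega⟩
    · exact ⟨0 + 1, by omega, by omega⟩
  have hex : ∃ s, ∀ j j', d (x j) = i → d (x j') = i → par^[s] (x j) = par^[s] (x j') :=
    ⟨i, fun j j' hj hj' ↦ by rw [← hj, hroot, ← hroot j', hj, hj']⟩
  obtain ⟨h, hi, hsame, j₁, j₂, hj₁, hj₂, hne⟩ : ∃ h, h + 1 ≤ i ∧
      (∀ j j', d (x j) = i → d (x j') = i → par^[h + 1] (x j) = par^[h + 1] (x j')) ∧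
      ∃ j j', d (x j) = i ∧ d (x j') = i ∧ par^[h] (x j) ≠ par^[h] (x j') := by
    have hle : Nat.find hex ≤ i :=
      Nat.find_min' hex fun j j' hj hj' ↦ by rw [← hj, hroot, ← hroot j', hj, hj']
    have hpos : Nat.find hex ≠ 0 := by
      intro h0
      have := Nat.find_spec hex
      rw [h0] at this
      have h2 := hinj _ _ (this (j₀ + 2) j₀ (by rw [hstep, hj₀]) hj₀)
      rw [add_sub_cancel_left] at h2
      have := Int.le_of_dvd (by norm_num) h2
      omega
    obtain ⟨h, hh⟩ := Nat.exists_eq_succ_of_ne_zero hpos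
    refine ⟨h, by omega, ?_, ?_⟩
    · have := Nat.find_spec hex
      rwa [hh] at this
    · have := Nat.find_min hex (m := h) (by omega)
      push Not at this
      exact this
  refine ⟨2 * (h + 2), even_two_mul _, fun l hl ↦ ?_, ?_⟩
  · have hm : ((2 * l + 2 : ℕ) : ℤ) < n := by
      have h1 : 2 * (l + 1) ≤ k * (g - 2) := by
        calc 2 * (l + 1) ≤ 2 * ((g / 2 - 1) * k) := by omega
          _ = k * (2 * (g / 2 - 1)) := by ring
          _ ≤ k * (g - 2) := Nat.mul_le_mul_left _ (by omega)
      have h2 : ((2 * (l + 1) : ℕ) : ℤ) ≤ ((k * (g - 2) : ℕ) : ℤ) := by exact_mod_cast h1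
      push_cast [Nat.cast_sub (show 2 ≤ g by omega)] at h2 ⊢
      omega
    rw [show 2 * (h + 2) + 2 * l = 2 * l + 2 + 2 * (h + 1) by ring]
    by_contra hcon
    have key := iff_add_two_of_forall_isPathFun hinj hper hadj hchord hr hrn (m := 2 * l + 2)
      (by omega) hm (χ := fun v ↦ d v = i ∧ par^[h] v = par^[h] (x j₁)) fun p hp ↦ ?_
    · have hper2 := periodic_add_mul (f := fun j ↦ d (x j) = i ∧ par^[h] (x j) = par^[h] (x j₁)) key
      have hdper := periodic_add_mul (f := fun j ↦ d (x j) = i) fun j ↦ by rw [hstep]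
      obtain ⟨q, hq⟩ : ∃ q, j₂ = j₁ + 2 * q := by
        rcases Int.even_or_odd' (j₂ - j₁) with ⟨q, hq | hq⟩
        · exact ⟨q, by omega⟩
        · exfalso
          have h1 := (hdper q (j₁ + 1)).1 (by rwa [show j₁ + 1 + 2 * q = j₂ by omega])
          have := hL.level_adj _ _ (hadj j₁)
          omega
      apply hne
      rw [hq]
      exact ((hper2 q j₁).2 ⟨hj₁, rfl⟩).2.symm
    · have hlev : ∀ t ≤ l + 1, d (p (2 * t)) = d (p 0) := by
        intro t
        induction t with
        | zero => intro _; rfl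
        | succ t ih =>
          intro ht
          have h0 := ih (by omega)
          have hd : ∀ s ≤ 2 * l + 2, d (p s) = i ∨ d (p s) = i + 1 := fun s hs ↦ by
            obtain ⟨j, hj⟩ := hp.mem s hs
            rw [← hj]
            exact hxd j
          have h1 := hL.level_adj _ _ (hp.adj (2 * t) (by omega))
          have h2 := hL.level_adj _ _ (hp.adj (2 * t + 1) (by omega))
          have h3 := hd (2 * t) (by omega)
          have h4 := hd (2 * t + 1) (by omega)
          have h5 := hd (2 * t + 1 + 1) (by omega)
          rw [show 2 * (t + 1) = 2 * t + 1 + 1 by ring]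
          omega
      have hend : d (p (2 * l + 2)) = d (p 0) := hlev (l + 1) le_rfl
      rw [hend]
      refine and_congr_right fun h0 ↦ ?_
      suffices par^[h] (p 0) = par^[h] (p (2 * l + 2)) by rw [this]
      by_contra hne'
      obtain ⟨a, ha⟩ := hp.mem 0 (by omega)
      obtain ⟨b, hb⟩ := hp.mem (2 * l + 2) le_rfl
      refine hcon (hL.exists_isCycle ⟨fun t ht ↦ ?_, hp.adj, hp.inj⟩ (by omega) hi h0
        (hend.trans h0) hne' ?_)
      · obtain ⟨j, hj⟩ := hp.mem t ht
        rw [← hj]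
        exact hxd j
      · rw [← ha, ← hb]
        exact hsame a b (by rw [ha, h0]) (by rw [hb, hend, h0])
  · have h1 := hrad (x (j₀ + 1))
    rw [hj₀'] at h1
    calc ((2 * (h + 2) : ℕ) : ℕ∞) ≤ ((2 * (i + 1) : ℕ) : ℕ∞) := by
          exact_mod_cast (by omega : 2 * (h + 2) ≤ 2 * (i + 1))
      _ = 2 * ((i + 1 : ℕ) : ℕ∞) := by push_cast; ring
      _ ≤ 2 * G.radius := by gcongr
end

section
/- Let H be a graph consisting of a cycle together with exactly one chord of that cycle, and let (A, B) be a partition of the vertex set of H with both A and B nonempty. Then either H contains, for every positive integer s < |V(H)|, a path of length s with one endpoint in A and the other endpoint in B, or H is bipartite with bipartition exactly (A, B). -/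
/-- The periods of an integer sequence are the multiples of a single period. -/
lemma exists_nat_periodic_iff_dvd {α : Type*} (χ : ℤ → α) :
    ∃ t : ℕ, ∀ c : ℤ, Function.Periodic χ c ↔ (t : ℤ) ∣ c := by
  let P : AddSubgroup ℤ :=
    { carrier := {c | Function.Periodic χ c}
      zero_mem' := fun x => by simp
      add_mem' := fun h h' => Function.Periodic.add_period h h'
      neg_mem' := fun h => Function.Periodic.neg h }
  obtain ⟨g, hg⟩ := Int.subgroup_cyclic P
  refine ⟨g.natAbs, fun c => ?_⟩
  have hc : c ∈ P ↔ g ∣ c := by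
    rw [hg, AddSubgroup.mem_closure_singleton, dvd_def]
    simp only [smul_eq_mul, mul_comm, eq_comm]
  rw [Int.natAbs_dvd]
  exact hc

/-- Two sequences with a common period that agree on a full period agree everywhere. -/
lemma Function.Periodic.eq_of_eq_on_period {α : Type*} {f g : ℤ → α} {t : ℤ} (ht : 0 < t)
    (hf : Function.Periodic f t) (hg : Function.Periodic g t) (m : ℤ)
    (h : ∀ j, m ≤ j → j < m + t → f j = g j) (x : ℤ) : f x = g x := by
  have hy := h (toIcoMod ht m x) (left_le_toIcoMod ht m x) (toIcoMod_lt_right ht m x)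
  rw [toIcoMod, hf.sub_zsmul_eq, hg.sub_zsmul_eq] at hy
  exact hy

/-- Colourings of the cycle of length `n` with a chord from `0` to `r`, in which the ends of every
path of length `s` have the same colour, are constant or alternate along all edges. -/
lemma alternating_of_path_ends_eq {χ : ℤ → Prop} {n r s : ℤ}
    (hr : 1 < r) (hrn : r + 1 < n) (hs : 0 < s) (hsn : s < n)
    (hχ : ¬ Function.Periodic χ 1)
    (hpn : Function.Periodic χ n) (hps : Function.Periodic χ s)
    (hdd : ∀ j k, 0 ≤ j → 0 ≤ k → j + k + 1 = s → j < n - r → k < r → χ (-j) = χ (r - k))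
    (huu : ∀ j k, 0 ≤ j → 0 ≤ k → j + k + 1 = s → j < r → k < n - r → χ j = χ (r + k))
    (hdu : ∀ j k, 0 ≤ j → 0 ≤ k → j + k + 1 = s → j + k < n - r → χ (-j) = χ (r + k))
    (hud : ∀ j k, 0 ≤ j → 0 ≤ k → j + k + 1 = s → j + k < r → χ j = χ (r - k)) :
    (∀ x, χ (x + 1) = ¬ χ x) ∧ (χ r = ¬ χ 0) := by
  obtain ⟨t, ht⟩ := exists_nat_periodic_iff_dvd χ
  have hts := (ht s).1 hps
  have htn := (ht n).1 hpn
  have hpt := (ht t).2 dvd_rfl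
  have ht0 : 0 < (t : ℤ) := by
    rcases Nat.eq_zero_or_pos t with h | h
    · subst h; simp at hts; omega
    · exact_mod_cast h
  have hts' : (t : ℤ) ≤ s := Int.le_of_dvd hs hts
  have htns : (t : ℤ) ≤ n - s := Int.le_of_dvd (by omega) (dvd_sub htn hts)
  have ht1 : ¬ (t : ℤ) ∣ 1 := fun h => hχ ((ht 1).2 h)
  have add_right (c : ℤ) : Function.Periodic (fun x => χ (x + c)) t := fun x => by
    change χ (x + t + c) = χ (x + c)
    rw [← hpt (x + c)]; congr 1; ring
  have sub_left (c : ℤ) : Function.Periodic (fun x => χ (c - x)) t := fun x => by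
    change χ (c - (x + t)) = χ (c - x)
    rw [← hpt (c - (x + t))]; congr 1; ring
  have hrt : (t : ℤ) ≤ r := by
    by_contra hlt
    have key : Function.Periodic χ (r - 1) := by
      intro x
      refine (add_right (r - 1)).eq_of_eq_on_period ht0 hpt (1 - s) (fun j h1 h2 => ?_) x
      have h := hdu (-j) (s - 1 + j) (by omega) (by omega) (by omega) (by omega)
      rw [neg_neg] at h
      change χ (j + (r - 1)) = χ j
      rw [h, ← hps (j + (r - 1))]; congr 1; ring
    have := Int.le_of_dvd (by omega) ((ht _).1 key)
    omega
  have hnrt : (t : ℤ) ≤ n - r := by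
    by_contra hlt
    have key : Function.Periodic χ (r + 1) := by
      intro x
      refine (add_right (r + 1)).eq_of_eq_on_period ht0 hpt 0 (fun j h1 h2 => ?_) x
      have h := hud j (s - 1 - j) (by omega) (by omega) (by omega) (by omega)
      change χ (j + (r + 1)) = χ j
      rw [h, ← hps (r - (s - 1 - j))]; congr 1; ring
    have h' : (t : ℤ) ∣ n - (r + 1) := dvd_sub htn ((ht _).1 key)
    have := Int.le_of_dvd (by omega) h'
    omega
  have hrefl₁ (x : ℤ) : χ (r + 1 - x) = χ x := by
    refine (sub_left (r + 1)).eq_of_eq_on_period ht0 hpt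
      (1 - t - max 0 (s - r)) (fun y h1 h2 => ?_) x
    have h := hdd (-y) (s - 1 + y) (by omega) (by omega) (by omega) (by omega) (by omega)
    rw [neg_neg] at h
    change χ (r + 1 - y) = χ y
    rw [h, ← hps (r - (s - 1 + y))]; congr 1; ring
  have hrefl₂ (x : ℤ) : χ (r - 1 - x) = χ x := by
    refine (sub_left (r - 1)).eq_of_eq_on_period ht0 hpt
      (max 0 (s - n + r)) (fun y h1 h2 => ?_) x
    have h := huu y (s - 1 - y) (by omega) (by omega) (by omega) (by omega) (by omega)
    change χ (r - 1 - y) = χ y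
    rw [h, ← hps (r - 1 - y)]; congr 1; ring
  have hp2 : Function.Periodic χ 2 := fun x => by
    rw [← hrefl₁ (x + 2), ← hrefl₂ x]; congr 1; ring
  have hne (x : ℤ) : χ (x + 1) ≠ χ x := fun hx => hχ fun y => by
    refine Function.Periodic.eq_of_eq_on_period (f := fun y => χ (y + 1)) (t := 2) (by norm_num)
      (fun z => ?_) hp2 x (fun j h1 h2 => ?_) y
    · change χ (z + 2 + 1) = χ (z + 1)
      rw [← hp2 (z + 1)]; congr 1; ring
    · obtain rfl | rfl : j = x ∨ j = x + 1 := by omega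
      · exact hx
      · rw [hx, ← hp2 x]; congr 1; ring
  have halt (x : ℤ) : χ (x + 1) = ¬ χ x := by
    have := hne x
    by_cases h : χ x <;> by_cases h' : χ (x + 1) <;> simp_all
  refine ⟨halt, ?_⟩
  have h := halt r
  have h' := hrefl₁ 0
  rw [sub_zero] at h'
  rw [h'] at h
  rw [h, not_not]

/-- An injective sequence of successively adjacent vertices is traversed by a path. -/
lemma SimpleGraph.exists_isPath_of_injOn {V : Type*} {G : SimpleGraph V} (s : ℕ) (f : ℕ → V)
    (hadj : ∀ i < s, G.Adj (f i) (f (i + 1))) (hinj : Set.InjOn f (Set.Iic s)) :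
    ∃ p : G.Walk (f 0) (f s), p.IsPath ∧ p.length = s ∧ ∀ v ∈ p.support, ∃ i ≤ s, f i = v := by
  induction s with
  | zero => exact ⟨.nil, .nil, rfl, by simp⟩
  | succ s ih =>
    obtain ⟨p, hp, hl, hsupp⟩ := ih (fun i hi => hadj i (by omega))
      (hinj.mono (Set.Iic_subset_Iic.2 (by omega)))
    refine ⟨p.concat (hadj s (by omega)), hp.concat (fun hmem => ?_) _, by simp [hl], fun v hv => ?_⟩
    · obtain ⟨i, hi, hfi⟩ := hsupp _ hmem
      have := hinj (Set.mem_Iic.2 (by omega)) (Set.mem_Iic.2 le_rfl) hfi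
      omega
    · rw [SimpleGraph.Walk.support_concat, List.mem_append] at hv
      rcases hv with hv | hv
      · obtain ⟨i, hi, hfi⟩ := hsupp _ hv
        exact ⟨i, by omega, hfi⟩
      · exact ⟨s + 1, le_rfl, (List.mem_singleton.1 hv).symm⟩


/-- Let `H` be a graph consisting of a cycle (on the vertices of
`ZMod n`, with `i` adjacent to `i+1`) together with exactly one chord `{a, b}`
(so `a ≠ b` and `a, b` are not adjacent on the cycle), and let `(A, Aᶜ)` be a
partition of the vertices with both parts nonempty. Then either `H` contains, for
every positive `s < |V(H)|`, a path of length `s` with one endpoint in `A` and the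
other in `Aᶜ`, or `H` is bipartite with bipartition exactly `(A, Aᶜ)`. -/
theorem cycle_with_chord_AB_paths
    (n : ℕ) (hn : 3 ≤ n) (a b : ZMod n)
    (hab : a ≠ b) (hchord₁ : b ≠ a + 1) (hchord₂ : a ≠ b + 1)
    (H : SimpleGraph (ZMod n))
    (hH : H = SimpleGraph.fromEdgeSet
      ({e | ∃ i : ZMod n, e = s(i, i + 1)} ∪ {s(a, b)}))
    (A : Set (ZMod n)) (hA : A.Nonempty) (hB : Aᶜ.Nonempty) :
    (∀ s : ℕ, 0 < s → s < n →
      ∃ u ∈ A, ∃ w ∈ Aᶜ, ∃ p : H.Walk u w, p.IsPath ∧ p.length = s) ∨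
    (∀ u v : ZMod n, H.Adj u v → ((u ∈ A ∧ v ∈ Aᶜ) ∨ (u ∈ Aᶜ ∧ v ∈ A))) := by
  rw [or_iff_not_imp_left]
  intro hno
  push Not at hno
  obtain ⟨s, hs, hsn, hno⟩ := hno
  have : NeZero n := ⟨by omega⟩
  have : Fact (1 < n) := ⟨by omega⟩
  have hadj (u v : ZMod n) :
      H.Adj u v ↔ (v = u + 1 ∨ u = v + 1 ∨ (u = a ∧ v = b) ∨ (u = b ∧ v = a)) := by
    subst hH
    simp only [SimpleGraph.fromEdgeSet_adj, Set.mem_union, Set.mem_ofPred_eq,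
      Set.mem_singleton_iff, Sym2.eq_iff]
    constructor
    · rintro ⟨⟨i, ⟨rfl, rfl⟩ | ⟨rfl, rfl⟩⟩ | h, -⟩ <;> tauto
    · rintro (rfl | rfl | ⟨rfl, rfl⟩ | ⟨rfl, rfl⟩)
      · exact ⟨.inl ⟨u, by simp⟩, by simp⟩
      · exact ⟨.inl ⟨v, by simp⟩, by simp⟩
      · exact ⟨.inr (by simp), hab⟩
      · exact ⟨.inr (by simp), hab.symm⟩
  set r : ℕ := (b - a).val with hr
  have hb : b = a + ((r : ℤ) : ZMod n) := by simp [hr]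
  have hrlt : r < n := ZMod.val_lt _
  have hr0 : r ≠ 0 := fun h => hab (by simp [hb, h])
  have hr1 : r ≠ 1 := fun h => hchord₁ (by simp [hb, h])
  have hrn : r + 1 ≠ n := fun h => hchord₂ <| by
    have : ((r : ZMod n) + 1) = 0 := by
      rw [← Nat.cast_add_one, h, ZMod.natCast_self]
    rw [hb]; push_cast; rw [add_assoc, this, add_zero]
  let χ : ℤ → Prop := fun x => a + (x : ZMod n) ∈ A
  have ends_eq (L : ℤ) (f : ℕ → ℤ)
      (hstep : ∀ i < s, f (i + 1) = f i + 1 ∨ f (i + 1) = f i - 1 ∨ (f i = 0 ∧ f (i + 1) = r))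
      (hinj : ∀ i j, i ≤ s → j ≤ s → f i = f j → i = j)
      (hL : ∀ i ≤ s, L ≤ f i ∧ f i < L + n) : χ (f 0) = χ (f s) := by
    obtain ⟨p, hp, hl, -⟩ := SimpleGraph.exists_isPath_of_injOn (G := H) s
      (fun i => a + (f i : ZMod n))
      (fun i hi => by
        rw [hadj]
        rcases hstep i hi with h | h | ⟨h, h'⟩
        · left; rw [h]; push_cast; ring
        · right; left; rw [h]; push_cast; ring
        · right; right; left; simp [h, h', hb])
      (fun i hi j hj hij => by
        refine hinj i j hi hj ?_
        have h := (ZMod.intCast_eq_intCast_iff_dvd_sub _ _ _).1 (add_left_cancel hij)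
        have h1 := hL i hi
        have h2 := hL j hj
        have := Int.eq_zero_of_abs_lt_dvd h (abs_lt.2 ⟨by omega, by omega⟩)
        omega)
    apply propext
    constructor
    · intro h0
      by_contra hs'
      exact hno _ h0 _ hs' p hp hl
    · intro hs'
      by_contra h0
      exact hno _ hs' _ h0 p.reverse hp.reverse (by simpa using hl)
  have ends_eq_chord (ε δ L : ℤ) (j k : ℤ) (hj : 0 ≤ j) (hk : 0 ≤ k) (hjk : j + k + 1 = s)
      (hε : ε = 1 ∨ ε = -1) (hδ : δ = 1 ∨ δ = -1)
      (hdisj : ∀ x y, 0 ≤ x → x ≤ j → 0 ≤ y → y ≤ k →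
        ε * x ≠ r + δ * y ∧ L ≤ ε * x ∧ ε * x < L + n ∧ L ≤ r + δ * y ∧ r + δ * y < L + n) :
      χ (ε * j) = χ (r + δ * k) := by
    have h := ends_eq L (fun i => if (i : ℤ) ≤ j then ε * (j - i) else r + δ * (i - j - 1))
      (fun i hi => by
        push_cast
        split_ifs <;> rcases hε with rfl | rfl <;> rcases hδ with rfl | rfl <;> omega)
      (fun i i' hi hi' hii' => by
        split_ifs at hii' with h1 h2 h2
        · rcases hε with rfl | rfl <;> omega
        · exact absurd hii' (hdisj _ _ (by omega) (by omega) (by omega) (by omega)).1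
        · exact absurd hii'.symm (hdisj _ _ (by omega) (by omega) (by omega) (by omega)).1
        · rcases hδ with rfl | rfl <;> omega)
      (fun i hi => by
        split_ifs with h1
        · have := hdisj (j - i) 0 (by omega) (by omega) le_rfl hk
          exact ⟨this.2.1, this.2.2.1⟩
        · exact (hdisj 0 (i - j - 1) le_rfl hj (by omega) (by omega)).2.2.2)
    have hsj : ¬ (s : ℤ) ≤ j := by omega
    have hsk : (s : ℤ) - j - 1 = k := by omega
    simpa [hj, hsj, hsk] using h
  have hpn : Function.Periodic χ n := fun x => by simp [χ]
  have hps : Function.Periodic χ s := fun x => by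
    have := ends_eq x (fun i => x + i) (fun i hi => by push_cast; omega)
      (fun i j _ _ h => by simpa using h) (fun i hi => by omega)
    simpa using this.symm
  have mem_iff (u : ZMod n) : u ∈ A ↔ χ (u - a).val := by simp [χ]
  have hχ : ¬ Function.Periodic χ 1 := fun h => by
    obtain ⟨u, hu⟩ := hA
    obtain ⟨w, hw⟩ := hB
    rw [mem_iff] at hu
    rw [Set.mem_compl_iff, mem_iff] at hw
    have h0 (m : ℕ) : χ m = χ 0 := by simpa using h.nat_mul_eq m
    rw [h0] at hu hw
    exact hw hu
  obtain ⟨halt, hchord⟩ := alternating_of_path_ends_eq (χ := χ) (n := n) (r := r) (s := s)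
    (by omega) (by omega) (by omega) (by omega) hχ hpn hps
    (fun j k hj hk hjk h1 h2 => by
      simpa [sub_eq_add_neg] using ends_eq_chord (-1) (-1) (r + 1 - n) j k hj hk hjk (.inr rfl)
        (.inr rfl) (fun x y _ _ _ _ => by omega))
    (fun j k hj hk hjk h1 h2 => by
      simpa using ends_eq_chord 1 1 0 j k hj hk hjk (.inl rfl)
        (.inl rfl) (fun x y _ _ _ _ => by omega))
    (fun j k hj hk hjk h1 => by
      simpa using ends_eq_chord (-1) 1 (-j) j k hj hk hjk (.inr rfl)
        (.inl rfl) (fun x y _ _ _ _ => by omega))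
    (fun j k hj hk hjk h1 => by
      simpa [sub_eq_add_neg] using ends_eq_chord 1 (-1) 0 j k hj hk hjk (.inl rfl)
        (.inr rfl) (fun x y _ _ _ _ => by omega))
  have hsucc (u : ZMod n) : u + 1 ∈ A ↔ u ∉ A := by
    have h := halt (u - a).val
    simpa [χ, ← add_assoc] using h
  have hab' : b ∈ A ↔ a ∉ A := by
    rw [hb]
    simpa [χ] using hchord
  intro u v huv
  simp only [Set.mem_compl_iff]
  rcases (hadj u v).1 huv with rfl | rfl | ⟨rfl, rfl⟩ | ⟨rfl, rfl⟩
  · have := hsucc u; tauto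
  · have := hsucc v; tauto
  · tauto
  · tauto
end

section
/- Let k ≥ 2 be a natural number and let G be a graph of finite girth g whose average degree is at least 2k. Then G contains a cycle of length at least (g − 2)·k + 2 that has at least one chord, i.e., there is an edge of G joining two vertices of the cycle that are not adjacent on the cycle. -/
theorem Finset.add_card_sub_one_mul_le_of_spaced {a d : ℕ} (s : Finset ℕ)
    (ha : ∀ i ∈ s, a ≤ i) (hd : ∀ i ∈ s, ∀ j ∈ s, i < j → i + d ≤ j)
    (m : ℕ) (hm : m ∈ s) (hmax : ∀ i ∈ s, i ≤ m) : a + (s.card - 1) * d ≤ m := by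
  induction s using Finset.induction_on_max generalizing m with
  | empty => simp at hm
  | insert x s hx ih =>
    have hxs : x ∉ s := fun h ↦ lt_irrefl x (hx x h)
    have hmx : m = x := by
      rcases Finset.mem_insert.1 hm with h | h
      · exact h
      · exact absurd (hmax x (Finset.mem_insert_self x s)) (not_le.2 (hx m h))
    subst hmx
    rw [Finset.card_insert_of_notMem hxs]
    rcases s.eq_empty_or_nonempty with rfl | hs
    · simpa using ha m (by simp)
    · have h1 := ih (fun i hi ↦ ha i (Finset.mem_insert_of_mem hi))
        (fun i hi j hj ↦ hd i (Finset.mem_insert_of_mem hi) j (Finset.mem_insert_of_mem hj))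
        (s.max' hs) (s.max'_mem hs) (fun i hi ↦ s.le_max' i hi)
      have h2 := hd _ (Finset.mem_insert_of_mem (s.max'_mem hs)) m hm (hx _ (s.max'_mem hs))
      obtain ⟨c, hc⟩ : ∃ c, s.card = c + 1 := ⟨s.card - 1, by have := hs.card_pos; omega⟩
      rw [hc] at h1 ⊢
      simp only [Nat.add_sub_cancel] at h1 ⊢
      rw [add_mul]
      omega

namespace SimpleGraph

variable {V : Type*} {G : SimpleGraph V}

theorem Walk.IsPath.start_notMem_support_drop {u v : V} {p : G.Walk u v} (hp : p.IsPath)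
    {i : ℕ} (hi : 0 < i) (hil : i ≤ p.length) : u ∉ (p.drop i).support := by
  intro h
  obtain ⟨n, hn, hnl⟩ := Walk.mem_support_iff_exists_getVert.1 h
  rw [Walk.drop_length] at hnl
  rw [Walk.drop_getVert, hp.getVert_eq_start_iff (by omega)] at hn
  omega

theorem Walk.IsPath.exists_isCycle_of_adj_start_of_lt {u v : V} {p : G.Walk u v} (hp : p.IsPath)
    {i j : ℕ} (hi : 0 < i) (hij : i < j) (hj : j ≤ p.length)
    (hui : G.Adj u (p.getVert i)) (huj : G.Adj u (p.getVert j)) :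
    ∃ c : G.Walk u u, c.IsCycle ∧ c.length = j - i + 2 := by
  have hend : (p.drop i).getVert (j - i) = p.getVert j := by
    rw [Walk.drop_getVert, Nat.add_sub_cancel' hij.le]
  have hadj : G.Adj ((p.drop i).getVert (j - i)) u := hend ▸ huj.symm
  have hu : u ∉ ((p.drop i).take (j - i)).support := fun h ↦
    hp.start_notMem_support_drop hi (hij.le.trans hj)
      (((p.drop i).isSubwalk_take (j - i)).support_subset h)
  refine ⟨.cons hui (((p.drop i).take (j - i)).concat hadj), ?_, ?_⟩
  · rw [Walk.cons_isCycle_iff]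
    refine ⟨((hp.drop i).take _).concat hu hadj, fun h ↦ ?_⟩
    rw [Walk.edges_concat, List.concat_eq_append, List.mem_append, List.mem_singleton] at h
    rcases h with h | h
    · exact hu (Walk.fst_mem_support_of_mem_edges _ h)
    · rw [hend, Sym2.eq_swap, Sym2.congr_left] at h
      have := hp.getVert_injOn (show i ≤ p.length by omega) (show j ≤ p.length from hj) h
      omega
  · simp only [Walk.length_cons, Walk.length_concat, Walk.take_length, Walk.drop_length]
    omega

theorem Walk.IsPath.mk_start_getVert_notMem_edges {u v : V} {p : G.Walk u v} (hp : p.IsPath)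
    {i : ℕ} (hi : 1 < i) (hil : i ≤ p.length) : s(u, p.getVert i) ∉ p.edges := by
  intro h
  have := hp.getVert_injOn (show i ≤ p.length from hil) (show 1 ≤ p.length by omega)
    (hp.eq_snd_of_mem_edges h)
  omega

theorem exists_long_isCycle_with_chord_of_lt_degree [Fintype V] [Nonempty V] [DecidableRel G.Adj]
    {k g : ℕ} (hk : 2 ≤ k) (hg : ∀ (v : V) (c : G.Walk v v), c.IsCycle → g ≤ c.length)
    (hdeg : ∀ v, k < G.degree v) :
    ∃ (v : V) (c : G.Walk v v), c.IsCycle ∧ (g - 2) * k + 2 ≤ c.length ∧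
      ∃ u w : V, u ∈ c.support ∧ w ∈ c.support ∧ G.Adj u w ∧ s(u, w) ∉ c.edges := by
  classical
  obtain ⟨u, v, p, hp, hmax⟩ := Walk.exists_isPath_forall_isPath_length_le_length G
  have hsupp : ∀ w, G.Adj u w → w ∈ p.support := by
    intro w hw
    by_contra h
    have := hmax _ _ _ (hp.cons h (h := hw.symm))
    simp at this
  set I := (Finset.range (p.length + 1)).filter fun i ↦ G.Adj u (p.getVert i) with hI
  have memI : ∀ {i}, i ∈ I ↔ i ≤ p.length ∧ G.Adj u (p.getVert i) := by
    simp [hI]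
  have hcard : k + 1 ≤ I.card := by
    refine (hdeg u).trans_le ((Finset.card_le_card fun w hw ↦ ?_).trans
      (Finset.card_image_le (s := I) (f := p.getVert)))
    rw [mem_neighborFinset] at hw
    obtain ⟨n, rfl, hn⟩ := Walk.mem_support_iff_exists_getVert.1 (hsupp w hw)
    exact Finset.mem_image_of_mem _ (memI.2 ⟨hn, hw⟩)
  have hpos : ∀ i ∈ I, 1 ≤ i := by
    intro i hi
    rcases Nat.eq_zero_or_pos i with rfl | h
    · simpa using (memI.1 hi).2
    · exact h
  have hspaced : ∀ i ∈ I, ∀ j ∈ I, i < j → i + (g - 2) ≤ j := by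
    intro i hi j hj hij
    obtain ⟨c, hc, hlen⟩ := hp.exists_isCycle_of_adj_start_of_lt (hpos i hi) hij (memI.1 hj).1
      (memI.1 hi).2 (memI.1 hj).2
    have := hg u c hc
    omega
  have hne : I.Nonempty := Finset.card_pos.1 (by omega)
  obtain ⟨m, hm, hmI⟩ : ∃ m ∈ I, ∀ i ∈ I, i ≤ m := ⟨I.max' hne, I.max'_mem hne, I.le_max'⟩
  have hbound := I.add_card_sub_one_mul_le_of_spaced hpos hspaced m hm hmI
  have hmul : k * (g - 2) ≤ (I.card - 1) * (g - 2) := Nat.mul_le_mul_right _ (by omega)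
  obtain ⟨i, hi, hi1⟩ : ∃ i ∈ I, i ∉ ({1, m} : Finset ℕ) :=
    Finset.exists_mem_notMem_of_card_lt_card (Finset.card_le_two.trans_lt (by omega))
  simp only [Finset.mem_insert, Finset.mem_singleton, not_or] at hi1
  have h1 := hpos i hi
  have him := hmI i hi
  obtain ⟨hml, hum⟩ := memI.1 hm
  have hlen : (p.take m).length = m := by rw [Walk.take_length]; omega
  have hgi : (p.take m).getVert i = p.getVert i := by rw [Walk.take_getVert, min_eq_right him]
  refine ⟨u, .cons hum (p.take m).reverse, ?_, ?_, u, p.getVert i, by simp, ?_, (memI.1 hi).2, ?_⟩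
  · rw [Walk.cons_isCycle_iff, Walk.edges_reverse, List.mem_reverse]
    refine ⟨(hp.take m).reverse, fun h ↦ ?_⟩
    exact hp.mk_start_getVert_notMem_edges (by omega) hml
      ((p.isSubwalk_take m).edges_subset h)
  · rw [Walk.length_cons, Walk.length_reverse, hlen, mul_comm]
    omega
  · rw [Walk.support_cons, Walk.support_reverse, List.mem_cons, List.mem_reverse, ← hgi]
    exact .inr (Walk.getVert_mem_support _ _)
  · rw [Walk.edges_cons, Walk.edges_reverse, List.mem_cons, List.mem_reverse]
    rintro (h | h)
    · rw [Sym2.congr_right] at h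
      exact hi1.2 (hp.getVert_injOn (memI.1 hi).1 hml h)
    · exact hp.mk_start_getVert_notMem_edges (by omega) (memI.1 hi).1
        ((p.isSubwalk_take m).edges_subset h)

theorem exists_long_isCycle_with_chord_of_mul_card_le {k g : ℕ} (hk : 2 ≤ k) (n : ℕ)
    {V : Type*} [Fintype V] [Nonempty V] {G : SimpleGraph V} [DecidableRel G.Adj]
    (hn : Fintype.card V = n)
    (hg : ∀ (v : V) (c : G.Walk v v), c.IsCycle → g ≤ c.length)
    (he : k * Fintype.card V ≤ G.edgeFinset.card) :
    ∃ (v : V) (c : G.Walk v v), c.IsCycle ∧ (g - 2) * k + 2 ≤ c.length ∧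
      ∃ u w : V, u ∈ c.support ∧ w ∈ c.support ∧ G.Adj u w ∧ s(u, w) ∉ c.edges := by
  classical
  induction n generalizing V with
  | zero => exact absurd hn Fintype.card_ne_zero
  | succ n ih =>
    by_cases hdeg : ∀ v, k < G.degree v
    · exact exists_long_isCycle_with_chord_of_lt_degree hk hg hdeg
    push Not at hdeg
    obtain ⟨x, hx⟩ := hdeg
    have hcard : Fintype.card ({x}ᶜ : Set V) = n := by
      rw [Fintype.card_compl_set, hn]
      simp
    have hne : n ≠ 0 := by
      rintro rfl
      have := G.card_edgeFinset_le_card_choose_two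
      rw [hn, zero_add, Nat.choose_eq_zero_of_lt one_lt_two] at this
      rw [hn] at he
      omega
    have : Nonempty ({x}ᶜ : Set V) := Fintype.card_pos_iff.1 (by omega)
    let f : G.induce {x}ᶜ ↪g G := Embedding.induce _
    obtain ⟨v, c, hc, hlen, u, w, hu, hw, huw, hchord⟩ := ih (G := G.induce {x}ᶜ) hcard
      (fun v c hc ↦ by simpa using hg _ _ (hc.map (f := f.toHom) f.injective)) (by
        rw [card_edgeFinset_induce_compl_singleton, card_edgeFinset_deleteIncidenceSet, hcard]
        rw [hn, mul_add] at he
        omega)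
    refine ⟨_, c.map f.toHom, hc.map f.injective, by simpa using hlen, f u, f w, ?_, ?_,
      f.map_adj_iff.2 huw, ?_⟩
    · rw [Walk.support_map]
      exact List.mem_map_of_mem hu
    · rw [Walk.support_map]
      exact List.mem_map_of_mem hw
    · rw [Walk.edges_map]
      intro h
      obtain ⟨e, he, hee⟩ := List.mem_map.1 h
      have : e = s(u, w) := Sym2.map.injective f.injective hee
      exact hchord (this ▸ he)

end SimpleGraph


/-- Let `k ≥ 2` and let `G` be a graph of finite girth `g` whose
average degree is at least `2k`. Then `G` contains a cycle of length at least
`(g − 2)·k + 2` having at least one chord, i.e. an edge of `G` joining two vertices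
of the cycle that are not adjacent along the cycle. -/
theorem long_cycle_with_chord
    {V : Type*} [Fintype V] [Nonempty V] (G : SimpleGraph V) (k g : ℕ)
    (hk : 2 ≤ k)
    (hgirth : G.girth = (g : ℕ∞))
    (havg : 2 * k * Fintype.card V ≤ 2 * G.edgeSet.ncard) :
    ∃ (v : V) (c : G.Walk v v), c.IsCycle ∧ (g - 2) * k + 2 ≤ c.length ∧
      ∃ u w : V, u ∈ c.support ∧ w ∈ c.support ∧ G.Adj u w ∧ s(u, w) ∉ c.edges := by
  classical
  have hgn : G.girth = g := by exact_mod_cast hgirth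
  refine SimpleGraph.exists_long_isCycle_with_chord_of_mul_card_le hk _ rfl
    (fun v c hc ↦ hgn ▸ SimpleGraph.girth_le_length hc) ?_
  rw [← SimpleGraph.coe_edgeFinset, Set.ncard_coe_finset, mul_assoc] at havg
  omega
end

section
/- Let G be a connected graph with chromatic number at least 2k + 2, let v₀ be a vertex of G, and for each i let V_i be the set of vertices at distance exactly i from v₀. Then there exists a level l such that the subgraph of G induced by V_l has chromatic number at least k + 1. -/
/-- Colouring the even and the odd distance levels with disjoint palettes of `k` colours. -/
theorem SimpleGraph.colorable_two_mul_of_levels {V : Type*} (G : SimpleGraph V) {k : ℕ}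
    (v₀ : V)
    (h : ∀ l : ℕ, (G.induce {v : V | G.dist v₀ v = l}).Colorable k) :
    G.Colorable (2 * k) := by
  let c (l : ℕ) : (G.induce {v : V | G.dist v₀ v = l}).Coloring (Fin k) := (h l).some
  have hc : ∀ (l : ℕ) {u v : V} (hu : G.dist v₀ u = l) (hv : G.dist v₀ v = l),
      G.Adj u v → c l ⟨u, hu⟩ ≠ c l ⟨v, hv⟩ := fun l _ _ _ _ huv => (c l).valid huv
  let C : G.Coloring (Fin 2 × Fin k) := SimpleGraph.Coloring.mk
    (fun v => (Fin.ofNat 2 (G.dist v₀ v), c (G.dist v₀ v) ⟨v, rfl⟩)) <| by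
      intro u v huv heq
      obtain ⟨hpar, hcol⟩ := Prod.mk.inj heq
      have hmod : G.dist v₀ u % 2 = G.dist v₀ v % 2 := congrArg Fin.val hpar
      have hdist : G.dist v₀ v = G.dist v₀ u := by
        have := huv.diff_dist_adj (u := v₀)
        omega
      have transport : ∀ (l : ℕ) (hl : G.dist v₀ v = l),
          c (G.dist v₀ v) ⟨v, rfl⟩ = c l ⟨v, hl⟩ := by
        rintro _ rfl
        rfl
      exact hc _ rfl hdist huv (hcol.trans (transport _ hdist))
  simpa using C.colorable

/-- Let `G` be a connected graph with chromatic number at least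
`2k + 2`, let `v₀` be a vertex, and let `V_l` be the set of vertices at distance
exactly `l` from `v₀`. Then some level `l` induces a subgraph of chromatic number
at least `k + 1`. -/
theorem level_with_large_chromatic_number
    {V : Type*} [Fintype V] (G : SimpleGraph V) (k : ℕ)
    (hconn : G.Connected)
    (hchrom : (2 * k + 2 : ℕ∞) ≤ G.chromaticNumber)
    (v₀ : V) :
    ∃ l : ℕ,
      (k + 1 : ℕ∞) ≤ (G.induce {v : V | G.dist v₀ v = l}).chromaticNumber := by
  by_contra! hlt
  have hcol : G.Colorable (2 * k) := G.colorable_two_mul_of_levels v₀ fun l => by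
    rw [← SimpleGraph.chromaticNumber_le_iff_colorable]
    exact Order.le_of_lt_add_one (hlt l)
  have hle : ((2 * k + 2 : ℕ) : ℕ∞) ≤ ((2 * k : ℕ) : ℕ∞) := by
    simpa using hchrom.trans hcol.chromaticNumber_le
  have := Nat.cast_le.mp hle
  omega
end

section
/- Let k ≥ 2 be a natural number, let G be a connected bipartite graph of average degree at least 4k, let v₀ be a vertex of G, and for each i let V_i be the set of vertices at distance exactly i from v₀. Then there exists l ≥ 0 such that the subgraph of G induced by V_l ∪ V_{l+1} has at least k·|V_l ∪ V_{l+1}| edges. -/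
/-- Every edge of a graph lies in the subgraph induced by two consecutive distance levels. -/
theorem SimpleGraph.Connected.exists_adj_subset_levels {V : Type*} {G : SimpleGraph V}
    (hconn : G.Connected) (v₀ : V) {a b : V} (hab : G.Adj a b) :
    ∃ l, (l = G.dist v₀ a ∨ l = G.dist v₀ b) ∧
      (G.dist v₀ a = l ∨ G.dist v₀ a = l + 1) ∧ (G.dist v₀ b = l ∨ G.dist v₀ b = l + 1) := by
  have h₁ := hconn.dist_triangle (u := v₀) (v := a) (w := b)
  have h₂ := hconn.dist_triangle (u := v₀) (v := b) (w := a)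
  rw [SimpleGraph.dist_eq_one_iff_adj.2 hab] at h₁
  rw [SimpleGraph.dist_eq_one_iff_adj.2 hab.symm] at h₂
  refine ⟨min (G.dist v₀ a) (G.dist v₀ b), ?_, ?_, ?_⟩ <;> omega

/-- The fibres of a bounded function into `ℕ` have total size the size of the domain. -/
theorem Fintype.sum_ncard_fiber_eq_card {V : Type*} [Fintype V] (f : V → ℕ) {N : ℕ}
    (hN : ∀ v, f v < N) :
    ∑ l ∈ Finset.range N, {v | f v = l}.ncard = Fintype.card V := by
  classical
  rw [← Finset.card_univ, Finset.card_eq_sum_card_fiberwise (f := f) (t := Finset.range N)]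
  · refine Finset.sum_congr rfl fun l _ => ?_
    rw [← Set.ncard_coe_finset]
    simp
  · intro v _
    simpa using hN v

/-- The edges of a connected graph are covered by the subgraphs induced by consecutive levels. -/
theorem SimpleGraph.Connected.ncard_edgeSet_le_sum_levels {V : Type*} [Finite V]
    {G : SimpleGraph V} (hconn : G.Connected) (v₀ : V) {N : ℕ} (hN : ∀ v, G.dist v₀ v < N) :
    G.edgeSet.ncard ≤ ∑ l ∈ Finset.range N,
      (G.induce ({v : V | G.dist v₀ v = l} ∪ {v : V | G.dist v₀ v = l + 1})).edgeSet.ncard := by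
  have hcover : G.edgeSet ⊆ ⋃ l ∈ Finset.range N, Sym2.map Subtype.val ''
      (G.induce ({v : V | G.dist v₀ v = l} ∪ {v : V | G.dist v₀ v = l + 1})).edgeSet := by
    intro e he
    induction e with
    | h a b =>
      obtain ⟨l, hl, ha, hb⟩ := hconn.exists_adj_subset_levels v₀ he
      have hlN : l < N := by rcases hl with rfl | rfl <;> exact hN _
      exact Set.mem_biUnion (Finset.mem_range.2 hlN) ⟨s(⟨a, ha⟩, ⟨b, hb⟩), he, rfl⟩
  calc G.edgeSet.ncard ≤ _ := Set.ncard_le_ncard hcover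
    _ ≤ _ := Finset.set_ncard_biUnion_le _ _
    _ ≤ _ := Finset.sum_le_sum fun l _ => Set.ncard_image_le


/-- Let `k ≥ 2`, let `G` be a connected bipartite graph of
average degree at least `4k`, let `v₀` be a vertex, and let `V_i` be the set of
vertices at distance exactly `i` from `v₀`. Then for some `l`, the subgraph
induced by `V_l ∪ V_{l+1}` has at least `k·|V_l ∪ V_{l+1}|` edges. -/
theorem dense_pair_of_levels
    {V : Type*} [Fintype V] (G : SimpleGraph V) (k : ℕ)
    (hk : 2 ≤ k)
    (hconn : G.Connected)
    (hbip : G.Colorable 2)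
    (havg : 4 * k * Fintype.card V ≤ 2 * G.edgeSet.ncard)
    (v₀ : V) :
    ∃ l : ℕ,
      k * ({v : V | G.dist v₀ v = l} ∪ {v : V | G.dist v₀ v = l + 1}).ncard ≤
        (G.induce ({v : V | G.dist v₀ v = l} ∪ {v : V | G.dist v₀ v = l + 1})).edgeSet.ncard := by
  by_contra! hlt
  obtain ⟨N, hN⟩ : ∃ N, ∀ v, G.dist v₀ v < N :=
    ⟨Finset.univ.sup (G.dist v₀) + 1, fun v =>
      Nat.lt_succ_of_le (Finset.le_sup (f := G.dist v₀) (Finset.mem_univ v))⟩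
  have hedges := hconn.ncard_edgeSet_le_sum_levels v₀ hN
  have hlower := Fintype.sum_ncard_fiber_eq_card _ hN
  have hupper := Fintype.sum_ncard_fiber_eq_card _ (fun v => (hN v).trans N.lt_succ_self)
  rw [Finset.sum_range_succ'] at hupper
  have hlevels : ∑ l ∈ Finset.range N,
      ({v : V | G.dist v₀ v = l} ∪ {v : V | G.dist v₀ v = l + 1}).ncard
        ≤ 2 * Fintype.card V := by
    have := Finset.sum_le_sum fun l (_ : l ∈ Finset.range N) =>
      Set.ncard_union_le {v : V | G.dist v₀ v = l} {v : V | G.dist v₀ v = l + 1}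
    rw [Finset.sum_add_distrib] at this
    omega
  have hstrict := Finset.sum_lt_sum_of_nonempty
    (Finset.nonempty_range_iff.2 (Nat.ne_zero_of_lt (hN v₀))) fun l _ => hlt l
  rw [← Finset.mul_sum] at hstrict
  have := Nat.mul_le_mul_left k hlevels
  linarith
end

section
/- Let H be a graph consisting of an even cycle together with exactly one chord, and suppose the vertices of the cycle alternate between sets A and B (so (A, B) is the bipartition of the cycle). If the chord joins two vertices of the same class (both in A or both in B), then for every positive integer s < |V(H)| there is a path in H of length s with one endpoint in A and the other in B. -/
/-- An injective sequence of `s + 1` vertices whose consecutive pairs lie in `E` traces a path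
of length `s` in `SimpleGraph.fromEdgeSet E`. -/
theorem exists_isPath_fromEdgeSet_of_injOn {V : Type*} {E : Set (Sym2 V)} (f : ℕ → V) (s : ℕ)
    (hE : ∀ i < s, s(f i, f (i + 1)) ∈ E) (hf : Set.InjOn f (Set.Iic s)) :
    ∃ p : (SimpleGraph.fromEdgeSet E).Walk (f 0) (f s),
      p.IsPath ∧ p.length = s ∧ ∀ v ∈ p.support, ∃ i ≤ s, v = f i := by
  induction s with
  | zero => exact ⟨.nil, by simp, rfl, fun v hv => ⟨0, le_rfl, by simpa using hv⟩⟩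
  | succ s ih =>
    obtain ⟨p, hp, hl, hs⟩ := ih (fun i hi => hE i (by omega))
      (hf.mono fun i (hi : i ≤ s) => Set.mem_Iic.2 (by omega))
    have hne : ∀ i ≤ s, f (s + 1) ≠ f i := fun i hi h => by
      have := hf (Set.mem_Iic.2 le_rfl) (Set.mem_Iic.2 (by omega)) h
      omega
    have hadj : (SimpleGraph.fromEdgeSet E).Adj (f s) (f (s + 1)) :=
      (SimpleGraph.fromEdgeSet_adj E).2 ⟨hE s (by omega), (hne s le_rfl).symm⟩
    refine ⟨p.concat hadj, hp.concat (fun h => ?_) hadj, by simp [hl], fun v hv => ?_⟩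
    · obtain ⟨i, hi, h⟩ := hs _ h
      exact hne i hi h
    · rw [SimpleGraph.Walk.support_concat, List.mem_append,
        List.mem_singleton] at hv
      rcases hv with hv | rfl
      · obtain ⟨i, hi, h⟩ := hs v hv
        exact ⟨i, by omega, h⟩
      · exact ⟨s + 1, le_rfl, rfl⟩

/-- Translating an integer sequence that is injective and stays in a window of fewer than `n`
consecutive steps gives an injective sequence in `ZMod n`. -/
theorem ZMod.injOn_add_intCast {n : ℕ} (a : ZMod n) (g : ℕ → ℤ) (t : Set ℕ)
    (hg : Set.InjOn g t) (hw : ∀ i ∈ t, ∀ j ∈ t, g i - g j < n) :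
    Set.InjOn (fun i => a + (g i : ZMod n)) t := by
  intro i hi j hj h
  have hdvd : (n : ℤ) ∣ g i - g j := by
    rw [← ZMod.intCast_zmod_eq_zero_iff_dvd _ n]
    simpa [sub_eq_zero] using h
  refine hg hi hj (sub_eq_zero.1 (Int.eq_zero_of_abs_lt_dvd hdvd (abs_lt.2 ⟨?_, hw i hi j hj⟩)))
  linarith [hw j hj i hi]

/-- For even `n`, adding an integer to an element of `ZMod n` changes parity accordingly. -/
theorem ZMod.even_val_add_intCast {n : ℕ} [NeZero n] (hn : Even n) (a : ZMod n) (z : ℤ) :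
    Even (a + (z : ZMod n)).val ↔ (Even a.val ↔ Even z) := by
  have h : ((a + (z : ZMod n)).val : ℤ) ≡ a.val + z [ZMOD n] := by
    rw [← ZMod.intCast_eq_intCast_iff]
    simp
  have h2 : (n : ℤ) ∣ a.val + z - (a + (z : ZMod n)).val := h.dvd
  obtain ⟨c, hc⟩ := h2
  have hev : Even ((a.val : ℤ) + z - (a + (z : ZMod n)).val) := by
    rw [hc]
    exact ((Int.even_coe_nat n).2 hn).mul_right c
  simp only [Int.even_sub, Int.even_add, Int.even_coe_nat] at hev
  tauto

/-- Let `H` consist of an even cycle (on `ZMod n`, `n` even,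
with `i` adjacent to `i+1`) together with exactly one chord `{a, b}`, where the
bipartition classes of the cycle are `A = {i | i.val even}` and `B = Aᶜ`. If the
chord joins two vertices of the same class, then for every positive `s < n` there
is a path in `H` of length `s` with one endpoint in `A` and the other in `B`. -/
theorem even_cycle_same_class_chord_AB_paths
    (n : ℕ) (hn : 4 ≤ n) (hne : Even n) (a b : ZMod n)
    (hab : a ≠ b) (hchord₁ : b ≠ a + 1) (hchord₂ : a ≠ b + 1)
    (hsame : (Even a.val ↔ Even b.val))
    (H : SimpleGraph (ZMod n))
    (hH : H = SimpleGraph.fromEdgeSet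
      ({e | ∃ i : ZMod n, e = s(i, i + 1)} ∪ {s(a, b)})) :
    ∀ s : ℕ, 0 < s → s < n →
      ∃ u, Even (ZMod.val u) ∧ ∃ w, ¬ Even (ZMod.val w) ∧
        ∃ p : H.Walk u w, p.IsPath ∧ p.length = s := by
  intro s hs hsn
  have : NeZero n := ⟨by omega⟩
  subst hH
  -- It suffices to find an integer sequence whose translate by `a` traces the path.
  suffices ∃ g : ℕ → ℤ, Set.InjOn g (Set.Iic s) ∧
      (∀ i ∈ Set.Iic s, ∀ j ∈ Set.Iic s, g i - g j < n) ∧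
      (∀ i < s, s(a + (g i : ZMod n), a + (g (i + 1) : ZMod n)) ∈
        ({e | ∃ i : ZMod n, e = s(i, i + 1)} ∪ {s(a, b)} : Set (Sym2 (ZMod n)))) ∧
      ¬ (Even (g 0) ↔ Even (g s)) by
    obtain ⟨g, hg, hw, hE, hpar⟩ := this
    obtain ⟨p, hp, hl, -⟩ := exists_isPath_fromEdgeSet_of_injOn (fun i => a + (g i : ZMod n)) s hE
      (ZMod.injOn_add_intCast a g _ hg hw)
    have h0 := ZMod.even_val_add_intCast hne a (g 0)
    have h1 := ZMod.even_val_add_intCast hne a (g s)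
    by_cases h : Even (a + (g 0 : ZMod n)).val
    · exact ⟨_, h, _, by tauto, p, hp, hl⟩
    · exact ⟨_, by tauto, _, h, p.reverse, hp.reverse, by simpa using hl⟩
  rcases Nat.even_or_odd s with hse | hso
  · obtain ⟨d, hd, hdn, rfl⟩ : ∃ d : ℕ, 0 < d ∧ d < n ∧ b = a + (d : ZMod n) :=
      ⟨(b - a).val, by simpa [Nat.pos_iff_ne_zero, sub_eq_zero] using hab.symm,
        ZMod.val_lt _, by simp⟩
    have hde : Even d := by
      have := ZMod.even_val_add_intCast hne a d
      simp only [Int.cast_natCast, Int.even_coe_nat] at this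
      tauto
    -- Climb `k` steps to `a`, cross the chord, then descend from `b`.
    obtain ⟨k, hk, hks, hkd⟩ : ∃ k : ℕ, k + d < n ∧ k < s ∧ s - 1 - k < d :=
      ⟨min (s - 1) (n - d - 1), by omega, by omega, by omega⟩
    refine ⟨fun i => if i ≤ k then (i : ℤ) - k else d + k + 1 - i, ?_, ?_, ?_, ?_⟩
    · intro i hi j hj h
      simp only [Set.mem_Iic] at hi hj h
      split_ifs at h <;> omega
    · intro i hi j hj
      simp only [Set.mem_Iic] at hi hj ⊢
      split_ifs <;> omega
    · intro i hi
      rcases lt_trichotomy i k with h | rfl | h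
      · left
        refine ⟨a + ((i : ZMod n) - k), ?_⟩
        beta_reduce
        rw [if_pos h.le, if_pos (by omega)]
        push_cast
        exact congrArg₂ (fun x y => s(x, y)) (by ring) (by ring)
      · right
        simp
      · left
        refine ⟨a + (d + k - i), ?_⟩
        beta_reduce
        rw [if_neg (by omega), if_neg (by omega), Sym2.eq_swap]
        push_cast
        exact congrArg₂ (fun x y => s(x, y)) (by ring) (by ring)
    · simp only [Nat.zero_le, if_true, if_neg (not_le.2 hks)]
      grind
  · refine ⟨fun i => i, fun i _ j _ h => by simpa using h, fun i hi j hj => ?_,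
      fun i _ => Or.inl ⟨a + i, by simp [add_assoc]⟩, ?_⟩
    · simp only [Set.mem_Iic] at hi hj ⊢
      omega
    · simpa using hso
end
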